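/- arXiv:2103.05731 — 2 statements merged into one kernel-verified Lean document; each statement's English description precedes it below -/
import Mathlib

section
/- (Granville) Assume the abc conjecture. Let n ≥ 2 be an integer, let f ∈ ℤ[X] be squarefree (in ℚ[X]), write deg f = nk + i with k ≥ 0 and 1 ≤ i ≤ n, and set e = nk + i − 1 − (gcd(n,i)+1)/(n−1); assume e > 0. Then for every ε > 0 there exists K > 0 such that: for every n-th power free integer d, all integers r, s with s ≥ 1 and gcd(r,s) = 1, and every y ∈ ℚ satisfying d·y^n = f(r/s), one has |r| ≤ K·|d|^{1/e + ε} and |s| ≤ K·|d|^{1/e + ε}. -/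
open Polynomial

/-- The radical of an integer: the product of its distinct prime factors. -/
def IntRadical (m : ℤ) : ℕ := ∏ p ∈ m.natAbs.primeFactors, p

/-- The abc conjecture of Masser–Oesterlé. -/
def ABCConjecture : Prop :=
  ∀ ε : ℝ, 0 < ε → ∃ K : ℝ, 0 < K ∧ ∀ a b c : ℤ,
    a ≠ 0 → b ≠ 0 → c ≠ 0 →
    IsCoprime a b → IsCoprime a c → IsCoprime b c →
    a + b = c →
    ((max (max |a| |b|) |c| : ℤ) : ℝ) ≤ K * (IntRadical (a * b * c) : ℝ) ^ (1 + ε)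

/-- `d` is `n`-th power free. -/
def NthPowerFree (n : ℕ) (d : ℤ) : Prop :=
  d ≠ 0 ∧ ∀ p : ℕ, p.Prime → ¬ ((p : ℤ) ^ n ∣ d)

/-- A `K`-point of the twist `C_d : d·y^n = f(x)`. -/
def HasTwistPoint (n : ℕ) (f : Polynomial ℤ) (d : ℤ) (K : Type) [CommRing K] : Prop :=
  ∃ x y : K, (d : K) * y ^ n = Polynomial.aeval x f

/-- The twist `C_d : d·y^n = f(x)` has points everywhere locally. -/
def EverywhereLocallySoluble (n : ℕ) (f : Polynomial ℤ) (d : ℤ) : Prop :=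
  HasTwistPoint n f d ℝ ∧ ∀ (p : ℕ) (_ : Fact p.Prime), HasTwistPoint n f d ℚ_[p]

/-- The twist `C_d` violates the Hasse principle. -/
def ViolatesHasse (n : ℕ) (f : Polynomial ℤ) (d : ℤ) : Prop :=
  EverywhereLocallySoluble n f d ∧ ¬ HasTwistPoint n f d ℚ

/-- `f` is weakly intersective: the primes modulo which `f` has a root have
relative natural density `1` in the primes. -/
def WeaklyIntersective (f : Polynomial ℤ) : Prop :=
  Filter.Tendsto (fun X : ℕ =>
      (Nat.card {ℓ : ℕ // ℓ ≤ X ∧ ℓ.Prime ∧ ∃ x : ZMod ℓ, Polynomial.aeval x f = 0} : ℝ) /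
      (Nat.card {ℓ : ℕ // ℓ ≤ X ∧ ℓ.Prime} : ℝ))
    Filter.atTop (nhds 1)

/-- Critical values of a nonconstant `f ∈ ℚ[X]` are roots of a polynomial of smaller degree. -/
lemma exists_critical_value_poly (f : ℚ[X]) (hf : f.natDegree ≠ 0) :
    ∃ g : ℚ[X], g ≠ 0 ∧ g.natDegree < f.natDegree ∧
      ∀ z : ℂ, aeval z (derivative f) = 0 → aeval (aeval z f) g = 0 := by
  have hd : derivative f ≠ 0 := fun h => hf (derivative_eq_zero.mp h)
  have := (AdjoinRoot.powerBasis hd).finite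
  set T := Algebra.lmul ℚ (AdjoinRoot (derivative f)) (AdjoinRoot.mk _ f) with hT
  refine ⟨LinearMap.charpoly T, (LinearMap.charpoly_monic _).ne_zero, ?_, fun z hz => ?_⟩
  · rw [LinearMap.charpoly_natDegree, (AdjoinRoot.powerBasis hd).finrank,
      AdjoinRoot.powerBasis_dim]
    exact natDegree_derivative_lt hf
  · have h0 := LinearMap.aeval_self_charpoly T
    rw [hT, aeval_algHom_apply, ← hT] at h0
    have h1 : aeval (AdjoinRoot.mk (derivative f) f) (LinearMap.charpoly T) = 0 := by
      have := congrArg (fun t => t 1) h0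
      simpa using this
    have h2 : AdjoinRoot.mk (derivative f) ((LinearMap.charpoly T).comp f) = 0 := by
      rw [← h1]
      exact (aeval_algHom_apply (AdjoinRoot.mkₐ (derivative f)) f (LinearMap.charpoly T)).symm
    obtain ⟨q, hq⟩ := AdjoinRoot.mk_eq_zero.mp h2
    rw [← aeval_comp, hq, map_mul, hz, zero_mul]

lemma exists_poly_rational_critical_values (m : ℕ) : ∀ f : ℚ[X], f ≠ 0 → f.natDegree ≤ m →
    ∃ h : ℚ[X], h.natDegree ≠ 0 ∧ ∃ S : Finset ℚ, ∀ z : ℂ,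
      (aeval z f = 0 ∨ aeval z (derivative h) = 0) → ∃ q ∈ S, aeval z h = (q : ℂ) := by
  induction m with
  | zero =>
    intro f hf hm
    refine ⟨X, by simp, ∅, fun z hz => ?_⟩
    rw [eq_C_of_natDegree_le_zero hm] at hz hf
    simp only [aeval_C, derivative_X, map_one, one_ne_zero, or_false] at hz
    simp at hz hf
    exact absurd hz hf
  | succ m ih =>
    intro f hf hm
    by_cases hf0 : f.natDegree = 0
    · exact ih f hf (by omega)
    obtain ⟨g, hg0, hgd, hg⟩ := exists_critical_value_poly f hf0
    obtain ⟨h, hh0, S, hS⟩ := ih g hg0 (by omega)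
    refine ⟨h.comp f, by simp [natDegree_comp, hh0, hf0], insert (h.eval 0) S, fun z hz => ?_⟩
    rw [derivative_comp, map_mul, aeval_comp, mul_eq_zero] at hz
    rw [aeval_comp]
    rcases hz with hz | hz | hz
    · refine ⟨_, Finset.mem_insert_self _ _, ?_⟩
      rw [hz]
      simpa using aeval_algebraMap_apply_eq_algebraMap_eval (A := ℂ) (0 : ℚ) h
    · obtain ⟨q, hq, h'⟩ := hS _ (Or.inl (hg z hz))
      exact ⟨q, Finset.mem_insert_of_mem hq, h'⟩
    · obtain ⟨q, hq, h'⟩ := hS _ (Or.inr hz)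
      exact ⟨q, Finset.mem_insert_of_mem hq, h'⟩

lemma exists_poly_three_points (a b c : ℚ) (hab : a < b) (hbc : b < c) :
    ∃ B : ℚ[X], B.natDegree ≠ 0 ∧ B.eval a = B.eval c ∧
      ∀ z : ℂ, aeval z (derivative B) = 0 → z = a ∨ z = b ∨ z = c := by
  obtain ⟨m, n, hm, hn, hmn⟩ : ∃ m n : ℕ, 0 < m ∧ 0 < n ∧ (n : ℚ) * (b - a) = m * (c - b) := by
    have hq : 0 < (b - a) / (c - b) := div_pos (by linarith) (by linarith)
    refine ⟨((b - a) / (c - b)).num.natAbs, ((b - a) / (c - b)).den,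
      Int.natAbs_pos.mpr (Rat.num_pos.mpr hq).ne', Rat.den_pos _, ?_⟩
    have h1 : (((((b - a) / (c - b)).num.natAbs : ℕ) : ℤ) : ℚ) = ((b - a) / (c - b)).num := by
      rw [Int.natAbs_of_nonneg (Rat.num_pos.mpr hq).le]
    rw [Int.cast_natCast] at h1
    rw [h1]
    have h2 := Rat.num_div_den ((b - a) / (c - b))
    have h3 : (((b - a) / (c - b)).den : ℚ) ≠ 0 := by simp
    have h4 : c - b ≠ 0 := by linarith
    generalize ((b - a) / (c - b)).num = u at *
    generalize ((b - a) / (c - b)).den = v at *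
    field_simp at h2
    linarith
  obtain ⟨m, rfl⟩ := Nat.exists_eq_succ_of_ne_zero hm.ne'
  obtain ⟨n, rfl⟩ := Nat.exists_eq_succ_of_ne_zero hn.ne'
  refine ⟨(X - C a) ^ (m + 1) * (X - C c) ^ (n + 1), ?_, by simp, fun z hz => ?_⟩
  · rw [natDegree_mul (pow_ne_zero _ (X_sub_C_ne_zero _)) (pow_ne_zero _ (X_sub_C_ne_zero _))]
    simp
  · simp only [derivative_mul, derivative_X_sub_C_pow, Nat.add_sub_cancel, map_add, map_mul,
      map_pow, map_sub, aeval_X, aeval_C, eq_ratCast, map_natCast] at hz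
    have key : (z - a) ^ m * (z - c) ^ n *
        ((m + 1) * (z - c) + (n + 1) * (z - a)) = 0 := by
      rw [← hz]; push_cast; ring
    have h5 : ((n : ℂ) + 1) * (b - a) = (m + 1) * (c - b) := by
      have := congrArg (fun t : ℚ => (t : ℂ)) hmn
      push_cast at this
      exact this
    rcases mul_eq_zero.mp key with h | h
    · rcases mul_eq_zero.mp h with h | h
      · left; exact sub_eq_zero.mp (eq_zero_of_pow_eq_zero h)
      · right; right; exact sub_eq_zero.mp (eq_zero_of_pow_eq_zero h)
    · right; left
      have h6 : ((m : ℂ) + 1 + (n + 1)) * (z - b) = 0 := by linear_combination h - h5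
      have h7 : (m : ℂ) + 1 + (n + 1) ≠ 0 := by exact_mod_cast (by omega : m + 1 + (n + 1) ≠ 0)
      exact sub_eq_zero.mp ((mul_eq_zero.mp h6).resolve_left h7)

lemma exists_poly_of_finset (m : ℕ) : ∀ S : Finset ℚ, S.card ≤ m →
    ∃ B : ℚ[X], B.natDegree ≠ 0 ∧ (∀ q ∈ S, B.eval q = 0 ∨ B.eval q = 1) ∧
      ∀ z : ℂ, aeval z (derivative B) = 0 → aeval z B = 0 ∨ aeval z B = 1 := by
  induction m with
  | zero =>
    intro S hS
    refine ⟨X, by simp, ?_, by simp⟩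
    simp [Finset.card_eq_zero.mp (Nat.le_zero.mp hS)]
  | succ m ih =>
    intro S hS
    by_cases h3 : 2 < S.card
    · obtain ⟨a, b, c, ha, hb, hc, hab, hbc⟩ :
          ∃ a b c, a ∈ S ∧ b ∈ S ∧ c ∈ S ∧ a < b ∧ b < c := by
        let φ := S.orderEmbOfFin rfl
        exact ⟨φ ⟨0, by omega⟩, φ ⟨1, by omega⟩, φ ⟨2, by omega⟩,
          S.orderEmbOfFin_mem rfl _, S.orderEmbOfFin_mem rfl _, S.orderEmbOfFin_mem rfl _,
          φ.strictMono (by simp), φ.strictMono (by simp)⟩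
      obtain ⟨β, hβ0, hβac, hβ⟩ := exists_poly_three_points a b c hab hbc
      have hcard : (S.image β.eval).card < S.card := by
        refine lt_of_le_of_ne Finset.card_image_le fun h => ?_
        have := Finset.card_image_iff.mp h ha hc hβac
        linarith
      obtain ⟨B, hB0, hBS, hB⟩ := ih (S.image β.eval) (by omega)
      refine ⟨B.comp β, by simp [natDegree_comp, hB0, hβ0], fun q hq => ?_, fun z hz => ?_⟩
      · rw [eval_comp]
        exact hBS _ (Finset.mem_image_of_mem _ hq)
      · rw [derivative_comp, map_mul, aeval_comp, mul_eq_zero] at hz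
        rw [aeval_comp]
        rcases hz with hz | hz
        · have key : ∀ q ∈ S, aeval (aeval (q : ℂ) β) B = 0 ∨ aeval (aeval (q : ℂ) β) B = 1 := by
            intro q hq
            have h1 : ∀ (p : ℚ[X]) (x : ℚ), aeval (x : ℂ) p = ((p.eval x : ℚ) : ℂ) := fun p x =>
              by simpa using aeval_algebraMap_apply_eq_algebraMap_eval (A := ℂ) x p
            rw [h1, h1]
            exact_mod_cast hBS _ (Finset.mem_image_of_mem _ hq)
          rcases hβ z hz with rfl | rfl | rfl
          exacts [key _ ha, key _ hb, key _ hc]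
        · exact hB _ hz
    · obtain ⟨a, b, hab, hS'⟩ : ∃ a b : ℚ, a ≠ b ∧ S ⊆ {a, b} := by
        obtain ⟨T, hST, hT⟩ := Infinite.exists_superset_card_eq S 2 (by omega)
        obtain ⟨a, b, hab, rfl⟩ := Finset.card_eq_two.mp hT
        exact ⟨a, b, hab, hST⟩
      have hba : (b - a)⁻¹ ≠ 0 := inv_ne_zero (sub_ne_zero.mpr hab.symm)
      refine ⟨C (b - a)⁻¹ * (X - C a), ?_, fun q hq => ?_, fun z hz => ?_⟩
      · rw [natDegree_C_mul hba]; simp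
      · have := hS' hq
        simp only [Finset.mem_insert, Finset.mem_singleton] at this
        rcases this with rfl | rfl
        · left; simp
        · right; simp [inv_mul_cancel₀ (sub_ne_zero.mpr hab.symm)]
      · rw [derivative_C_mul, derivative_X_sub_C, mul_one, aeval_C] at hz
        simp only [eq_ratCast, Rat.cast_eq_zero] at hz
        exact absurd hz hba

/-- Belyi's theorem for polynomials. -/
lemma exists_belyi_poly (f : ℚ[X]) (hf : f ≠ 0) :
    ∃ B : ℚ[X], B.natDegree ≠ 0 ∧ ∀ z : ℂ,
      (aeval z f = 0 ∨ aeval z (derivative B) = 0) → aeval z B = 0 ∨ aeval z B = 1 := by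
  obtain ⟨h, hh0, S, hS⟩ := exists_poly_rational_critical_values _ f hf le_rfl
  obtain ⟨B, hB0, hBS, hB⟩ := exists_poly_of_finset _ S le_rfl
  refine ⟨B.comp h, by simp [natDegree_comp, hB0, hh0], fun z hz => ?_⟩
  rw [derivative_comp, map_mul, aeval_comp, mul_eq_zero, or_left_comm, ← or_assoc] at hz
  rw [aeval_comp]
  rcases hz with hz | hz
  · obtain ⟨q, hq, h1⟩ := hS z (by tauto)
    have h2 : aeval (q : ℂ) B = ((B.eval q : ℚ) : ℂ) := by
      simpa using aeval_algebraMap_apply_eq_algebraMap_eval (A := ℂ) q B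
    rw [h1, h2]
    exact_mod_cast hBS q hq
  · exact hB _ hz

/-- The Belyi map as a polynomial identity, with the Riemann–Hurwitz degree bound. -/
lemma exists_belyi_identity (f : ℚ[X]) (hf : Squarefree f) :
    ∃ (B g q : ℚ[X]) (L : ℕ), B.natDegree ≠ 0 ∧ g ≠ 0 ∧
      f.natDegree + g.natDegree ≤ B.natDegree + 1 ∧ B * (B - 1) * q = (f * g) ^ L := by
  obtain ⟨B, hB0, hB⟩ := exists_belyi_poly f hf.ne_zero
  have hB1 : (B - 1).natDegree = B.natDegree := by
    rw [← C_1, natDegree_sub_C]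
  have hBne : B ≠ 0 := by rintro rfl; simp at hB0
  have hB1ne : B - 1 ≠ 0 := by intro h; rw [h] at hB1; simp at hB1; omega
  set A := B * (B - 1) with hA
  have hAne : A ≠ 0 := mul_ne_zero hBne hB1ne
  have hAdeg : A.natDegree = 2 * B.natDegree := by
    rw [hA, natDegree_mul hBne hB1ne, hB1]; ring
  have hd : derivative B ≠ 0 := fun h => hB0 (derivative_eq_zero.mp h)
  set R := UniqueFactorizationMonoid.radical A with hR
  have hRne : R ≠ 0 := UniqueFactorizationMonoid.radical_ne_zero
  have hRA : R ∣ A := UniqueFactorizationMonoid.radical_dvd_self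
  let ι := algebraMap ℚ ℂ
  have hι : Function.Injective ι := ι.injective
  have hroot : ∀ (p : ℚ[X]) (z : ℂ), p ≠ 0 → (z ∈ (p.map ι).roots ↔ aeval z p = 0) := by
    intro p z hp
    rw [mem_roots ((Polynomial.map_ne_zero_iff hι).mpr hp), IsRoot, eval_map_algebraMap]
  have hfA : f ∣ A := by
    have hsep : (f.map ι).Separable := (PerfectField.separable_iff_squarefree.mpr hf).map
    have : f.map ι ∣ A.map ι := by
      refine (IsAlgClosed.splits (f.map ι)).dvd_of_roots_le_roots
        ((Polynomial.map_ne_zero_iff hι).mpr hf.ne_zero) ?_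
      rw [Multiset.le_iff_subset (nodup_roots hsep)]
      intro z hz
      rw [hroot _ _ hf.ne_zero] at hz
      rw [hroot _ _ hAne, hA, map_mul, map_sub, map_one, mul_eq_zero, sub_eq_zero]
      exact hB z (Or.inl hz)
    exact (Polynomial.map_dvd_map' ι).mp this
  have hfR : f ∣ R := (UniqueFactorizationMonoid.dvd_radical_iff hf.isRadical hAne).mpr hfA
  obtain ⟨g, hg⟩ := hfR
  obtain ⟨L, q, hq⟩ := UniqueFactorizationMonoid.exists_dvd_radical_self_pow hAne
  have hgne : g ≠ 0 := by rintro rfl; exact hRne (by simpa using hg)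
  refine ⟨B, g, q, L, hB0, hgne, ?_, by rw [← hg, ← hq]⟩
  rw [← natDegree_mul hf.ne_zero hgne, ← hg]
  have hdvd : (derivative B * R).map ι ∣ A.map ι := by
    refine (IsAlgClosed.splits _).dvd_of_roots_le_roots
      ((Polynomial.map_ne_zero_iff hι).mpr (mul_ne_zero hd hRne)) ?_
    classical
    have hRsep : (R.map ι).Separable := (PerfectField.separable_iff_squarefree.mpr
      UniqueFactorizationMonoid.squarefree_radical).map
    have hdm : (derivative B).map ι ≠ 0 := (Polynomial.map_ne_zero_iff hι).mpr hd
    have hRm : R.map ι ≠ 0 := (Polynomial.map_ne_zero_iff hι).mpr hRne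
    have hBm : B.map ι ≠ 0 := (Polynomial.map_ne_zero_iff hι).mpr hBne
    have hB1m : (B - 1).map ι ≠ 0 := (Polynomial.map_ne_zero_iff hι).mpr hB1ne
    rw [Multiset.le_iff_count]
    intro z
    rw [Polynomial.map_mul, roots_mul (mul_ne_zero hdm hRm), Multiset.count_add, hA,
      Polynomial.map_mul, roots_mul (mul_ne_zero hBm hB1m), Multiset.count_add]
    have hR1 : Multiset.count z (R.map ι).roots ≤ 1 :=
      Multiset.nodup_iff_count_le_one.mp (nodup_roots hRsep) z
    by_cases hz : aeval z B = 0 ∨ aeval z B = 1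
    · have hmult : ∀ P : ℚ[X], P ≠ 0 → derivative P = derivative B → aeval z P = 0 →
          Multiset.count z ((derivative B).map ι).roots + 1 ≤ Multiset.count z (P.map ι).roots := by
        intro P hP hPd hPz
        have hpos : 0 < Multiset.count z (P.map ι).roots :=
          Multiset.count_pos.mpr ((hroot _ _ hP).mpr hPz)
        have hr : (P.map ι).IsRoot z := by rwa [IsRoot, eval_map_algebraMap]
        have := derivative_rootMultiplicity_of_root hr
        rw [derivative_map, hPd, ← count_roots, ← count_roots] at this
        omega
      rcases hz with hz | hz
      · have := hmult B hBne rfl hz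
        omega
      · have := hmult (B - 1) hB1ne (by simp) (by simp [hz])
        omega
    · have h1 : Multiset.count z ((derivative B).map ι).roots = 0 := by
        rw [Multiset.count_eq_zero, hroot _ _ hd]
        exact fun h => hz (hB z (Or.inr h))
      have h2 : Multiset.count z (R.map ι).roots = 0 := by
        rw [Multiset.count_eq_zero, hroot _ _ hRne]
        intro h
        obtain ⟨t, ht⟩ := hRA
        apply hz
        rw [← sub_eq_zero (b := (1 : ℂ)), ← mul_eq_zero]
        have : aeval z A = 0 := by rw [ht, map_mul, h, zero_mul]
        simpa [hA] using this
      omega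
  have hle := natDegree_le_of_dvd hdvd ((Polynomial.map_ne_zero_iff hι).mpr hAne)
  rw [natDegree_map, natDegree_map, natDegree_mul hd hRne, hAdeg, natDegree_derivative] at hle
  omega

/-- The homogenization of `p` evaluated at `(r, s)`, that is `s ^ deg p * p (r / s)`. -/
noncomputable def homogenizedEval (p : ℤ[X]) (r s : ℤ) : ℤ := (p.scaleRoots s).eval r

lemma homogenizedEval_mul (p q : ℤ[X]) (r s : ℤ) :
    homogenizedEval (p * q) r s = homogenizedEval p r s * homogenizedEval q r s := by
  simp [homogenizedEval, mul_scaleRoots_of_noZeroDivisors]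

lemma homogenizedEval_C (a r s : ℤ) : homogenizedEval (C a) r s = a := by
  simp only [homogenizedEval, scaleRoots_C, eval_C]

lemma homogenizedEval_pow (p : ℤ[X]) (L : ℕ) (r s : ℤ) :
    homogenizedEval (p ^ L) r s = homogenizedEval p r s ^ L := by
  induction L with
  | zero => simpa using homogenizedEval_C 1 r s
  | succ L ih => rw [pow_succ, homogenizedEval_mul, ih, pow_succ]

lemma cast_homogenizedEval (p : ℤ[X]) (r s : ℤ) (hs : s ≠ 0) :
    (homogenizedEval p r s : ℚ) = (s : ℚ) ^ p.natDegree * aeval ((r : ℚ) / s) p := by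
  have hs' : (s : ℚ) ≠ 0 := Int.cast_ne_zero.mpr hs
  have h := scaleRoots_eval₂_mul (p := p) (Int.castRingHom ℚ) ((r : ℚ) / s) s
  simp only [eq_intCast, mul_div_cancel₀ _ hs'] at h
  rw [aeval_def, homogenizedEval, algebraMap_int_eq, ← h, ← eq_intCast (Int.castRingHom ℚ) r,
    eval₂_at_apply]
  simp

lemma homogenizedEval_eq_sum (p : ℤ[X]) (r s : ℤ) :
    homogenizedEval p r s =
      ∑ j ∈ Finset.range (p.natDegree + 1), p.coeff j * s ^ (p.natDegree - j) * r ^ j := by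
  rw [homogenizedEval, eval_eq_sum_range, natDegree_scaleRoots]
  simp

lemma exists_homogenizedEval_eq_lead_add (p : ℤ[X]) :
    ∃ E : ℤ → ℤ → ℤ, (∀ r s, homogenizedEval p r s =
      p.leadingCoeff * r ^ p.natDegree + s * E r s) ∧
      ∃ C : ℝ, 0 < C ∧ ∀ (r s : ℤ) (H : ℝ), |(r : ℝ)| ≤ H → |(s : ℝ)| ≤ H →
        |(E r s : ℝ)| ≤ C * H ^ (p.natDegree - 1) := by
  refine ⟨fun r s => ∑ j ∈ Finset.range p.natDegree,
    p.coeff j * s ^ (p.natDegree - 1 - j) * r ^ j, fun r s => ?_,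
    1 + ∑ j ∈ Finset.range p.natDegree, |(p.coeff j : ℝ)|, by positivity, fun r s H hr hs => ?_⟩
  · rw [homogenizedEval_eq_sum, Finset.sum_range_succ, add_comm, Finset.mul_sum]
    congr 1
    · simp
    · refine Finset.sum_congr rfl fun j hj => ?_
      have : p.natDegree - j = p.natDegree - 1 - j + 1 := by
        have := Finset.mem_range.mp hj; omega
      rw [this]; ring
  · have hH : 0 ≤ H := (abs_nonneg _).trans hr
    push_cast
    refine (Finset.abs_sum_le_sum_abs _ _).trans ?_
    rw [add_mul, Finset.sum_mul]
    refine le_add_of_nonneg_of_le (by positivity) (Finset.sum_le_sum fun j hj => ?_)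
    rw [abs_mul, abs_mul, abs_pow, abs_pow, mul_assoc]
    refine mul_le_mul_of_nonneg_left ?_ (abs_nonneg _)
    calc |(s : ℝ)| ^ (p.natDegree - 1 - j) * |(r : ℝ)| ^ j
        ≤ H ^ (p.natDegree - 1 - j) * H ^ j := by gcongr
      _ = H ^ (p.natDegree - 1) := by
        rw [← pow_add]; congr 1; have := Finset.mem_range.mp hj; omega

lemma exists_abs_homogenizedEval_le (p : ℤ[X]) :
    ∃ C : ℝ, 0 < C ∧ ∀ (r s : ℤ) (H : ℝ), |(r : ℝ)| ≤ H → |(s : ℝ)| ≤ H →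
      |(homogenizedEval p r s : ℝ)| ≤ C * H ^ p.natDegree := by
  refine ⟨1 + ∑ j ∈ Finset.range (p.natDegree + 1), |(p.coeff j : ℝ)|, by positivity,
    fun r s H hr hs => ?_⟩
  have hH : 0 ≤ H := (abs_nonneg _).trans hr
  rw [homogenizedEval_eq_sum]
  push_cast
  refine (Finset.abs_sum_le_sum_abs _ _).trans ?_
  rw [add_mul, Finset.sum_mul]
  refine le_add_of_nonneg_of_le (by positivity) (Finset.sum_le_sum fun j hj => ?_)
  rw [abs_mul, abs_mul, abs_pow, abs_pow, mul_assoc]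
  refine mul_le_mul_of_nonneg_left ?_ (abs_nonneg _)
  calc |(s : ℝ)| ^ (p.natDegree - j) * |(r : ℝ)| ^ j
      ≤ H ^ (p.natDegree - j) * H ^ j := by gcongr
    _ = H ^ p.natDegree := by
      rw [← pow_add]; congr 1; have := Finset.mem_range.mp hj; omega

/-- The height lower bound `max |b(r, s)| |N s ^ deg b| ≫ max |r| |s| ^ deg b`. -/
lemma exists_height_pow_le (b : ℤ[X]) (hb : b.natDegree ≠ 0) (N : ℤ) (hN : N ≠ 0) :
    ∃ C : ℝ, 0 < C ∧ ∀ r s : ℤ, max |(r : ℝ)| |(s : ℝ)| ^ b.natDegree ≤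
      C * max |(homogenizedEval b r s : ℝ)| |((N * s ^ b.natDegree : ℤ) : ℝ)| := by
  obtain ⟨E, hE, C, hC, hEC⟩ := exists_homogenizedEval_eq_lead_add b
  refine ⟨3 + (2 * C) ^ b.natDegree, by positivity, fun r s => ?_⟩
  have hNs : |(s : ℝ)| ^ b.natDegree ≤ |((N * s ^ b.natDegree : ℤ) : ℝ)| := by
    push_cast
    rw [abs_mul, abs_pow]
    have : (1 : ℝ) ≤ |(N : ℝ)| := by exact_mod_cast Int.one_le_abs hN
    exact le_mul_of_one_le_left (by positivity) this
  have hlc : (1 : ℝ) ≤ |(b.leadingCoeff : ℝ)| := by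
    have : b.leadingCoeff ≠ 0 := leadingCoeff_ne_zero.mpr (by rintro rfl; simp at hb)
    exact_mod_cast Int.one_le_abs this
  have hEb := hEC r s _ (le_max_left _ _) (le_max_right _ _)
  have hEq := hE r s
  set α := homogenizedEval b r s
  set γ := N * s ^ b.natDegree
  have hα0 : (0 : ℝ) ≤ max |(α : ℝ)| |(γ : ℝ)| := by positivity
  have hT : (0 : ℝ) ≤ (2 * C) ^ b.natDegree := by positivity
  by_cases hrs : |(r : ℝ)| ≤ |(s : ℝ)|
  · rw [max_eq_right hrs]
    have := hNs.trans (le_max_right |(α : ℝ)| _)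
    nlinarith [mul_nonneg hT hα0]
  · push Not at hrs
    rw [max_eq_left hrs.le] at hEb ⊢
    have h1 : |(r : ℝ)| ^ b.natDegree ≤
        |(α : ℝ)| + |(s : ℝ)| * (C * |(r : ℝ)| ^ (b.natDegree - 1)) := by
      have h2 : ((b.leadingCoeff : ℝ)) * (r : ℝ) ^ b.natDegree = α - s * E r s := by
        rw [hEq]; push_cast; ring
      calc |(r : ℝ)| ^ b.natDegree ≤ |(b.leadingCoeff : ℝ)| * |(r : ℝ)| ^ b.natDegree :=
            le_mul_of_one_le_left (by positivity) hlc
        _ = |(α : ℝ) - s * E r s| := by rw [← h2, abs_mul, abs_pow]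
        _ ≤ |(α : ℝ)| + |(s : ℝ) * E r s| := abs_sub _ _
        _ ≤ _ := by rw [abs_mul]; gcongr
    have hpow : |(r : ℝ)| ^ b.natDegree = |(r : ℝ)| ^ (b.natDegree - 1) * |(r : ℝ)| := by
      rw [← pow_succ]; congr 1; omega
    by_cases hs : 2 * C * |(s : ℝ)| ≤ |(r : ℝ)|
    · have h3 : |(s : ℝ)| * (C * |(r : ℝ)| ^ (b.natDegree - 1)) * 2 ≤ |(r : ℝ)| ^ b.natDegree := by
        rw [hpow]
        nlinarith [pow_nonneg (abs_nonneg (r : ℝ)) (b.natDegree - 1)]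
      have := le_max_left |(α : ℝ)| |(γ : ℝ)|
      nlinarith [mul_nonneg hT hα0]
    · push Not at hs
      have h4 : |(r : ℝ)| ^ b.natDegree ≤ (2 * C) ^ b.natDegree * |(s : ℝ)| ^ b.natDegree := by
        rw [← mul_pow]; gcongr
      have h5 := hNs.trans (le_max_right |(α : ℝ)| _)
      have h6 := mul_le_mul_of_nonneg_left h5 hT
      nlinarith

lemma exists_height_le_of_root (p : ℤ[X]) (hp : p ≠ 0) :
    ∃ C : ℝ, 1 ≤ C ∧ ∀ r s : ℤ, 1 ≤ s → IsCoprime r s → aeval ((r : ℚ) / s) p = 0 →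
      max |(r : ℝ)| |(s : ℝ)| ≤ C := by
  classical
  refine ⟨1 + ∑ x ∈ (p.rootSet_finite ℚ).toFinset, (|(x.num : ℝ)| + (x.den : ℝ)),
    le_add_of_nonneg_right (by positivity), fun r s hs hrs h => ?_⟩
  have hx : (r : ℚ) / s ∈ (p.rootSet_finite ℚ).toFinset := by
    simp [mem_rootSet, hp, h]
  have hcop : Nat.Coprime r.natAbs s.natAbs := Int.isCoprime_iff_nat_coprime.mp hrs
  have h1 := Rat.num_div_eq_of_coprime (by omega : 0 < s) hcop
  have h2 := Rat.den_div_eq_of_coprime (by omega : 0 < s) hcop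
  have h3 := Finset.single_le_sum (f := fun x : ℚ => |(x.num : ℝ)| + (x.den : ℝ))
    (fun _ _ => by positivity) hx
  have h4 : ((((r : ℚ) / s).den : ℕ) : ℝ) = s := by exact_mod_cast h2
  simp only [h1, h4] at h3
  have h5 : |(s : ℝ)| = s := abs_of_nonneg (by exact_mod_cast (by omega : 0 ≤ s))
  have h6 : (0 : ℝ) ≤ s := h5 ▸ abs_nonneg _
  rw [h5]
  apply max_le <;> linarith [abs_nonneg (r : ℝ)]

lemma exists_int_poly_eq_mul (p : ℚ[X]) :
    ∃ N : ℤ, N ≠ 0 ∧ ∃ P : ℤ[X], P.map (Int.castRingHom ℚ) = C (N : ℚ) * p := by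
  obtain ⟨b, hb, h⟩ := IsLocalization.integerNormalization_spec (nonZeroDivisors ℤ) p
  refine ⟨b, nonZeroDivisors.ne_zero hb, _, h.trans ?_⟩
  rw [← Int.cast_smul_eq_zsmul ℚ, smul_eq_C_mul]

lemma natDegree_eq_of_map_eq_mul {P : ℤ[X]} {N : ℤ} {p : ℚ[X]} (hN : N ≠ 0)
    (h : P.map (Int.castRingHom ℚ) = C (N : ℚ) * p) : P.natDegree = p.natDegree := by
  rw [← natDegree_map_eq_of_injective (RingHom.injective_int (Int.castRingHom ℚ)) P, h,
    natDegree_C_mul (Int.cast_ne_zero.mpr hN)]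

lemma one_le_intRadical (m : ℤ) : 1 ≤ IntRadical m :=
  Finset.prod_pos fun _ hp => (Nat.prime_of_mem_primeFactors hp).pos

lemma dvd_intRadical {m : ℤ} (hm : m ≠ 0) {p : ℕ} (hp : p.Prime) (h : (p : ℤ) ∣ m) :
    p ∣ IntRadical m :=
  Finset.dvd_prod_of_mem (fun q => q) (Nat.mem_primeFactors.mpr
    ⟨hp, Int.natCast_dvd.mp h, Int.natAbs_ne_zero.mpr hm⟩)

/-- A power of the radical divides anything that all the prime powers involved divide. -/
lemma intRadical_pow_dvd {m : ℤ} {n X : ℕ}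
    (h : ∀ p : ℕ, p.Prime → (p : ℤ) ∣ m → p ^ n ∣ X) : IntRadical m ^ n ∣ X := by
  rw [IntRadical, ← Finset.prod_pow]
  refine Finset.prod_dvd_of_isRelPrime (fun p hp q hq hpq => ?_) fun p hp => ?_
  · exact Nat.coprime_iff_isRelPrime.mp (((Nat.coprime_primes (Nat.prime_of_mem_primeFactors hp)
      (Nat.prime_of_mem_primeFactors hq)).mpr hpq).pow n n)
  · exact h p (Nat.prime_of_mem_primeFactors hp)
      (Int.natCast_dvd.mpr (Nat.dvd_of_mem_primeFactors hp))

/-- The abc inequality for a possibly non-coprime triple whose common factor is bounded. -/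
lemma abc_of_dvd {ε K : ℝ} (hε : 0 < ε) (hK : 0 < K)
    (habc : ∀ a b c : ℤ, a ≠ 0 → b ≠ 0 → c ≠ 0 →
      IsCoprime a b → IsCoprime a c → IsCoprime b c → a + b = c →
      ((max (max |a| |b|) |c| : ℤ) : ℝ) ≤ K * (IntRadical (a * b * c) : ℝ) ^ (1 + ε))
    {a b c Δ : ℤ} {X : ℕ} (ha : a ≠ 0) (hb : b ≠ 0) (hc : c ≠ 0) (habc' : a + b = c)
    (hΔ : Δ ≠ 0) (hgcd : ∀ t : ℤ, t ∣ a → t ∣ c → t ∣ Δ) (hX0 : X ≠ 0)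
    (hX : ∀ p : ℕ, p.Prime → (p : ℤ) ∣ a * b * c → p ∣ X) :
    max |(a : ℝ)| |(c : ℝ)| ≤ |(Δ : ℝ)| * (K * (X : ℝ) ^ (1 + ε)) := by
  obtain ⟨a', ha'⟩ := Int.gcd_dvd_left a c
  obtain ⟨c', hc'⟩ := Int.gcd_dvd_right a c
  set δ : ℤ := (Int.gcd a c : ℤ) with hδ
  have hδ0 : δ ≠ 0 := by rintro h; rw [h] at ha'; simp at ha'; exact ha ha'
  have hcop : IsCoprime a' c' := by
    have h1 := Int.isCoprime_iff_gcd_eq_one.mpr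
      (Int.gcd_ediv_gcd_ediv_gcd_of_ne_zero_left (m := c) ha)
    rwa [← hδ, ha', hc', Int.mul_ediv_cancel_left _ hδ0, Int.mul_ediv_cancel_left _ hδ0] at h1
  have hb' : b = δ * (c' - a') := by rw [mul_sub, ← ha', ← hc']; omega
  have key := habc a' (c' - a') c' (by rintro rfl; simp at ha'; exact ha ha')
    (by intro h; rw [h] at hb'; simp at hb'; exact hb hb')
    (by rintro rfl; simp at hc'; exact hc hc')
    (by simpa [sub_eq_add_neg] using (IsCoprime.add_mul_left_right hcop (-1)))
    hcop
    (by simpa [sub_eq_add_neg, add_comm] using (IsCoprime.add_mul_left_left hcop.neg_left 1))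
    (by ring)
  have hrad : IntRadical (a' * (c' - a') * c') ≤ X := by
    refine Nat.le_of_dvd (Nat.pos_of_ne_zero hX0) ?_
    have := intRadical_pow_dvd (m := a' * (c' - a') * c') (n := 1) (X := X) (fun p hp h => ?_)
    · simpa using this
    · rw [pow_one]
      refine hX p hp (h.trans ?_)
      rw [hb']
      conv_rhs => rw [ha', hc']
      exact ⟨δ * δ * δ, by ring⟩
  have hδΔ : |(δ : ℝ)| ≤ |(Δ : ℝ)| := by
    have := Int.le_of_dvd (abs_pos.mpr hΔ)
      ((abs_dvd_abs _ _).mpr (hgcd δ (Int.gcd_dvd_left a c) (Int.gcd_dvd_right a c)))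
    exact_mod_cast this
  have hmax : max |(a' : ℝ)| |(c' : ℝ)| ≤ K * (X : ℝ) ^ (1 + ε) := by
    have h1 : K * (IntRadical (a' * (c' - a') * c') : ℝ) ^ (1 + ε) ≤ K * (X : ℝ) ^ (1 + ε) := by
      have : (IntRadical (a' * (c' - a') * c') : ℝ) ≤ X := by exact_mod_cast hrad
      gcongr
    refine le_trans ?_ (key.trans h1)
    push_cast
    exact max_le ((le_max_left _ _).trans (le_max_left _ _)) (le_max_right _ _)
  have ha2 : (a : ℝ) = δ * a' := by exact_mod_cast ha'
  have hc2 : (c : ℝ) = δ * c' := by exact_mod_cast hc'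
  rw [ha2, hc2, abs_mul, abs_mul, ← mul_max_of_nonneg _ _ (abs_nonneg _)]
  gcongr

lemma dvd_mul_leadingCoeff_pow (b : ℤ[X]) (N r s t : ℤ) (hrs : IsCoprime r s)
    (h1 : t ∣ homogenizedEval b r s) (h2 : t ∣ N * s ^ b.natDegree) :
    t ∣ N * b.leadingCoeff ^ b.natDegree := by
  obtain ⟨E, hE, -⟩ := exists_homogenizedEval_eq_lead_add b
  set M := b.natDegree
  set l := b.leadingCoeff
  have h3 : t ∣ (l * r ^ M) ^ M - (-(s * E r s)) ^ M := by
    refine h1.trans ?_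
    rw [hE, ← sub_neg_eq_add]
    exact sub_dvd_pow_sub_pow _ _ _
  have h4 : t ∣ N * l ^ M * (r ^ M) ^ M := by
    have h5 := (h3.mul_left N).add (h2.mul_right ((-E r s) ^ M))
    have h6 : (-(s * E r s)) ^ M = s ^ M * (-E r s) ^ M := by rw [← mul_pow]; ring
    rw [h6] at h5
    have h7 : N * l ^ M * (r ^ M) ^ M = N * ((l * r ^ M) ^ M - s ^ M * (-E r s) ^ M) +
        N * s ^ M * (-E r s) ^ M := by rw [mul_pow]; ring
    rwa [h7]
  have h5 : t ∣ N * l ^ M * s ^ M := by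
    rw [mul_right_comm]
    exact h2.mul_right (l ^ M)
  obtain ⟨u, v, huv⟩ := (hrs.pow (m := M * M) (n := M))
  have h6 := (h4.mul_left u).add (h5.mul_left v)
  have h7 : N * l ^ M = u * (N * l ^ M * (r ^ M) ^ M) + v * (N * l ^ M * s ^ M) := by
    rw [← pow_mul]
    linear_combination (- N * l ^ M) * huv
  rwa [h7]

lemma rpow_le_of_abc_bound {H ρ C₁ C₂ ε : ℝ} {M D G : ℕ} (hH : 1 ≤ H) (hρ : 0 < ρ)
    (hC₁ : 0 < C₁) (hC₂ : 0 < C₂) (hε : 0 < ε) (hM : M ≠ 0) (hDG : D + G ≤ M + 1)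
    (h : H ^ M ≤ C₂ * (C₁ * ρ * H ^ G) ^ (1 + ε / M)) :
    H ^ ((D : ℝ) - 1 - ε) ≤ C₂ ^ (1 / (1 + ε / M)) * C₁ * ρ := by
  have hH0 : 0 < H := by linarith
  have hM0 : (0 : ℝ) < M := by exact_mod_cast Nat.pos_of_ne_zero hM
  set t : ℝ := 1 + ε / M with ht
  have ht0 : 0 < t := by positivity
  have h1 : H ^ ((M : ℝ) * (1 / t)) ≤ C₂ ^ (1 / t) * (C₁ * ρ * H ^ G) := by
    have h2 := Real.rpow_le_rpow (by positivity) h (by positivity : 0 ≤ 1 / t)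
    rw [Real.mul_rpow hC₂.le (by positivity), ← Real.rpow_mul (by positivity),
      mul_one_div_cancel ht0.ne', Real.rpow_one, ← Real.rpow_natCast H M,
      ← Real.rpow_mul hH0.le] at h2
    exact h2
  have hDG' : (D : ℝ) + G ≤ M + 1 := by exact_mod_cast hDG
  have h3 : (M : ℝ) - ε ≤ M * (1 / t) := by
    rw [mul_one_div, le_div_iff₀ ht0, ht]
    have : ((M : ℝ) - ε) * (1 + ε / M) = M - ε * ε / M := by field_simp; ring
    rw [this]
    have : 0 ≤ ε * ε / M := by positivity
    linarith
  have h4 : H ^ ((D : ℝ) - 1 - ε) * H ^ (G : ℝ) ≤ H ^ ((M : ℝ) * (1 / t)) := by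
    rw [← Real.rpow_add hH0]
    exact Real.rpow_le_rpow_of_exponent_le hH (by linarith)
  rw [Real.rpow_natCast] at h4
  have h5 : 0 < H ^ G := by positivity
  refine le_of_mul_le_mul_right ?_ h5
  calc _ ≤ _ := h4.trans h1
    _ = _ := by ring

/-- The abc conjecture bounds the radical of `s * f(r, s)` from below (Elkies, Langevin). -/
theorem ABCConjecture.exists_rpow_le_intRadical (habc : ABCConjecture) (f : ℤ[X])
    (hsf : Squarefree (f.map (Int.castRingHom ℚ))) (ε : ℝ) (hε : 0 < ε) :
    ∃ C : ℝ, 0 < C ∧ ∀ r s : ℤ, 1 ≤ s → IsCoprime r s → homogenizedEval f r s ≠ 0 →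
      max |(r : ℝ)| |(s : ℝ)| ^ ((f.natDegree : ℝ) - 1 - ε) ≤
        C * (IntRadical (s * homogenizedEval f r s) : ℝ) := by
  obtain ⟨B, g, q, L, hB, hg, hdeg, hid⟩ := exists_belyi_identity _ hsf
  obtain ⟨N, hN, b, hb⟩ := exists_int_poly_eq_mul B
  obtain ⟨N₁, hN₁, g₁, hg₁⟩ := exists_int_poly_eq_mul g
  obtain ⟨N₂, hN₂, q₂, hq₂⟩ := exists_int_poly_eq_mul q
  have hbM := natDegree_eq_of_map_eq_mul hN hb
  have hgG := natDegree_eq_of_map_eq_mul hN₁ hg₁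
  rw [natDegree_map_eq_of_injective (RingHom.injective_int (Int.castRingHom ℚ)), ← hbM, ← hgG]
    at hdeg
  rw [← hbM] at hB
  have hZ : b * (b - C N) * q₂ * C (N₁ ^ L) = C (N ^ 2 * N₂) * (f * g₁) ^ L := by
    apply map_injective _ (RingHom.injective_int (Int.castRingHom ℚ))
    simp only [Polynomial.map_mul, Polynomial.map_sub, Polynomial.map_pow, hb, hg₁, hq₂, map_C,
      Int.coe_castRingHom, C_mul, C_pow]
    have : (f.map (Int.castRingHom ℚ) * (C (N₁ : ℚ) * g)) ^ L =
        C (N₁ : ℚ) ^ L * (f.map (Int.castRingHom ℚ) * g) ^ L := by rw [← mul_pow]; ring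
    rw [this, ← hid]
    ring
  have hg₁0 : g₁ ≠ 0 := by
    rintro rfl
    have : C (N₁ : ℚ) * g = 0 := by rw [← hg₁, Polynomial.map_zero]
    simp [hN₁, hg] at this
  have hM0 : (0 : ℝ) < b.natDegree := by exact_mod_cast Nat.pos_of_ne_zero hB
  obtain ⟨K, hK, hKabc⟩ := habc (ε / b.natDegree) (by positivity)
  obtain ⟨C₃, hC₃, hroot⟩ := exists_height_le_of_root g₁ hg₁0
  obtain ⟨C₄, hC₄, hheight⟩ := exists_height_pow_le b hB N hN
  obtain ⟨C₅, hC₅, hG⟩ := exists_abs_homogenizedEval_le g₁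
  have hlc : b.leadingCoeff ≠ 0 := leadingCoeff_ne_zero.mpr (by rintro rfl; simp at hB)
  set Δ := N * b.leadingCoeff ^ b.natDegree with hΔdef
  have hΔ : Δ ≠ 0 := mul_ne_zero hN (pow_ne_zero _ hlc)
  have hΔr : (0 : ℝ) < |(Δ : ℝ)| := abs_pos.mpr (Int.cast_ne_zero.mpr hΔ)
  obtain ⟨Q, hQ⟩ : ∃ Q : ℕ, Q = (N * N₂).natAbs := ⟨_, rfl⟩
  have hQ0 : Q ≠ 0 := hQ ▸ Int.natAbs_ne_zero.mpr (mul_ne_zero hN hN₂)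
  have hQr : (0 : ℝ) < Q := by exact_mod_cast Nat.pos_of_ne_zero hQ0
  set C₂ := C₄ * (|(Δ : ℝ)| * K)
  have hC₂ : 0 < C₂ := by positivity
  refine ⟨C₂ ^ (1 / (1 + ε / b.natDegree)) * (Q * C₅) +
    C₃ ^ |(f.natDegree : ℝ) - 1 - ε|, by positivity, fun r s hs hrs hF => ?_⟩
  have hs0 : s ≠ 0 := by omega
  set H := max |(r : ℝ)| |(s : ℝ)| with hH
  have hH1 : 1 ≤ H := by
    refine le_trans ?_ (le_max_right _ _)
    exact_mod_cast Int.one_le_abs hs0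
  have hρ1 : (1 : ℝ) ≤ IntRadical (s * homogenizedEval f r s) := by
    exact_mod_cast one_le_intRadical _
  set F := homogenizedEval f r s
  by_cases hG0 : homogenizedEval g₁ r s = 0
  · have h0 : aeval ((r : ℚ) / s) g₁ = 0 := by
      have := cast_homogenizedEval g₁ r s hs0
      rw [hG0, Int.cast_zero] at this
      exact (mul_eq_zero.mp this.symm).resolve_left (pow_ne_zero _ (Int.cast_ne_zero.mpr hs0))
    have h1 := hroot r s hs hrs h0
    have h2 : H ^ ((f.natDegree : ℝ) - 1 - ε) ≤ C₃ ^ |(f.natDegree : ℝ) - 1 - ε| :=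
      (Real.rpow_le_rpow_of_exponent_le hH1 (le_abs_self _)).trans
        (Real.rpow_le_rpow (by linarith) h1 (abs_nonneg _))
    have h3 : (0 : ℝ) < C₃ ^ |(f.natDegree : ℝ) - 1 - ε| := by positivity
    have h4 : 0 < C₂ ^ (1 / (1 + ε / b.natDegree)) * (Q * C₅) := by positivity
    nlinarith
  · have hsub : homogenizedEval (b - C N) r s =
        homogenizedEval b r s - N * s ^ b.natDegree := by
      have h1 := cast_homogenizedEval (b - C N) r s hs0
      have h2 := cast_homogenizedEval b r s hs0
      rw [natDegree_sub_C, map_sub, mul_sub, ← h2, aeval_C, algebraMap_int_eq,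
        Int.coe_castRingHom] at h1
      have : (homogenizedEval (b - C N) r s : ℚ) =
        ((homogenizedEval b r s - N * s ^ b.natDegree : ℤ) : ℚ) := by
        rw [h1]; push_cast; ring
      exact_mod_cast this
    have hval := congrArg (fun p => homogenizedEval p r s) hZ
    simp only [homogenizedEval_mul, homogenizedEval_pow, homogenizedEval_C, hsub] at hval
    set α := homogenizedEval b r s with hα
    set γ := N * s ^ b.natDegree with hγ
    set G := homogenizedEval g₁ r s
    have hne : N ^ 2 * N₂ * (F * G) ^ L ≠ 0 :=
      mul_ne_zero (mul_ne_zero (pow_ne_zero _ hN) hN₂) (pow_ne_zero _ (mul_ne_zero hF hG0))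
    have hα0 : α ≠ 0 := by intro h; rw [h] at hval; simp at hval; exact hne (by simpa using hval)
    have hβ0 : γ - α ≠ 0 := by
      intro h
      have h' : α - γ = 0 := by omega
      rw [h'] at hval
      exact hne (by rw [← hval]; ring)
    have hγ0 : γ ≠ 0 := mul_ne_zero hN (pow_ne_zero _ hs0)
    set ρ := IntRadical (s * F) with hρ
    have hsF : s * F ≠ 0 := mul_ne_zero hs0 hF
    have hkey := abc_of_dvd (X := Q * ρ * G.natAbs) (by positivity) hK hKabc hα0 hβ0 hγ0
      (by ring) hΔ (fun t h1 h2 => dvd_mul_leadingCoeff_pow b N r s t hrs h1 h2)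
      (mul_ne_zero (mul_ne_zero hQ0 (by have := one_le_intRadical (s * F); omega))
        (Int.natAbs_ne_zero.mpr hG0)) (by
          intro p hp hdvd
          have hp' : Prime (p : ℤ) := Nat.prime_iff_prime_int.mp hp
          have hcases : (p : ℤ) ∣ N * N₂ ∨ (p : ℤ) ∣ s * F ∨ (p : ℤ) ∣ G := by
            rcases hp'.dvd_or_dvd hdvd with h | h
            · have h1 : (p : ℤ) ∣ N ^ 2 * N₂ * (F * G) ^ L := by
                rw [← hval]
                refine dvd_mul_of_dvd_left (dvd_mul_of_dvd_left ?_ _) _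
                rw [← dvd_neg]
                convert h using 1
                ring
              rcases hp'.dvd_or_dvd h1 with h | h
              · rcases hp'.dvd_or_dvd h with h | h
                · exact Or.inl ((hp'.dvd_of_dvd_pow h).mul_right _)
                · exact Or.inl (h.mul_left _)
              · rcases hp'.dvd_or_dvd (hp'.dvd_of_dvd_pow h) with h | h
                · exact Or.inr (Or.inl (h.mul_left _))
                · exact Or.inr (Or.inr h)
            · rcases hp'.dvd_or_dvd h with h | h
              · exact Or.inl (h.mul_right _)
              · exact Or.inr (Or.inl ((hp'.dvd_of_dvd_pow h).mul_right _))
          rcases hcases with h | h | h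
          · exact dvd_mul_of_dvd_left (dvd_mul_of_dvd_left (hQ ▸ Int.natCast_dvd.mp h) _) _
          · exact dvd_mul_of_dvd_left (dvd_mul_of_dvd_right (dvd_intRadical hsF hp h) _) _
          · exact dvd_mul_of_dvd_right (Int.natCast_dvd.mp h) _)
    have hGb := hG r s H (le_max_left _ _) (le_max_right _ _)
    have hXle : (((Q * ρ * G.natAbs : ℕ) : ℝ)) ≤ Q * C₅ * ρ * H ^ g₁.natDegree := by
      push_cast
      rw [Nat.cast_natAbs, Int.cast_abs]
      calc (Q : ℝ) * ρ * |(G : ℝ)| ≤ Q * ρ * (C₅ * H ^ g₁.natDegree) := by gcongr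
        _ = _ := by ring
    have hfin := rpow_le_of_abc_bound (D := f.natDegree) (ρ := ρ) hH1 (by linarith)
      (by positivity : 0 < (Q : ℝ) * C₅) hC₂ hε hB hdeg (by
        calc H ^ b.natDegree ≤ C₄ * max |(α : ℝ)| |(γ : ℝ)| := hheight r s
          _ ≤ C₄ * (|(Δ : ℝ)| * (K * ((Q * ρ * G.natAbs : ℕ) : ℝ) ^ (1 + ε / b.natDegree))) := by
            gcongr
          _ ≤ C₄ * (|(Δ : ℝ)| * (K * (Q * C₅ * ρ * H ^ g₁.natDegree) ^ (1 + ε / b.natDegree))) := by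
            gcongr
          _ = _ := by ring)
    have h3 : (0 : ℝ) < C₃ ^ |(f.natDegree : ℝ) - 1 - ε| := by positivity
    nlinarith

/-- If `d` is `n`-th power free and `d * w ^ n` is an integer, then so is `w`. -/
lemma NthPowerFree.exists_int_eq {n : ℕ} {d : ℤ} (hd : NthPowerFree n d) {w : ℚ} {m : ℤ}
    (h : (d : ℚ) * w ^ n = m) : ∃ u : ℤ, w = u := by
  by_contra hw
  have hden : w.den ≠ 1 := fun h1 => hw ⟨w.num, ((Rat.den_eq_one_iff w).mp h1).symm⟩
  obtain ⟨p, hp, hpd⟩ := Nat.exists_prime_and_dvd hden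
  refine hd.2 p hp ?_
  have h1 : d * w.num ^ n = m * (w.den : ℤ) ^ n := by
    have h2 : (w.den : ℚ) ≠ 0 := by simp
    have h3 : (d : ℚ) * (w.num : ℚ) ^ n = m * (w.den : ℚ) ^ n := by
      rw [← h, mul_assoc, ← mul_pow, Rat.mul_den_eq_num]
    exact_mod_cast h3
  have hcop : IsCoprime ((w.den : ℤ) ^ n) (w.num ^ n) :=
    (Int.isCoprime_iff_nat_coprime.mpr (by simpa using w.reduced.symm)).pow
  have h4 : (w.den : ℤ) ^ n ∣ d := hcop.dvd_of_dvd_mul_right ⟨m, by rw [h1]; ring⟩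
  exact (pow_dvd_pow_of_dvd (Int.natCast_dvd_natCast.mpr hpd) n).trans h4

/-- The prime-by-prime estimate behind the upper bound for the radical. -/
lemma prime_pow_dvd_of_twist {n i : ℕ} (hn : 2 ≤ n) (hi1 : 1 ≤ i) (hin : i ≤ n)
    {d w s F l : ℤ} (hs : s ≠ 0) (hw : w ≠ 0)
    (heq : s ^ (n - i) * F = d * w ^ n) {p : ℕ} (hp : p.Prime)
    (hl : (p : ℤ) ∣ s → (p : ℤ) ∣ F → (p : ℤ) ∣ l) (hpsF : (p : ℤ) ∣ s * F) :
    (p : ℤ) ^ n ∣ l ^ n * d ^ (n - 1) * F * s ^ (Nat.gcd n i) := by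
  have hp' : Prime (p : ℤ) := Nat.prime_iff_prime_int.mp hp
  by_cases hpl : (p : ℤ) ∣ l
  · exact ((pow_dvd_pow_of_dvd hpl n).mul_right _ |>.mul_right _ |>.mul_right _)
  have hg : 1 ≤ Nat.gcd n i := Nat.gcd_pos_of_pos_right _ hi1
  have hpn : (p : ℤ) ^ n = p ^ (n - 1) * p := by rw [← pow_succ]; congr 1; omega
  by_cases hpd : (p : ℤ) ∣ d
  · have h1 : (p : ℤ) ^ (n - 1) ∣ d ^ (n - 1) := pow_dvd_pow_of_dvd hpd _
    have h2 : (p : ℤ) ∣ F * s ^ (Nat.gcd n i) := by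
      rcases hp'.dvd_or_dvd hpsF with h | h
      · exact (dvd_pow h (by omega)).mul_left _
      · exact h.mul_right _
    rw [hpn, mul_assoc (l ^ n * _), mul_comm (l ^ n)]
    exact mul_dvd_mul (h1.mul_right _) h2
  by_cases hps : (p : ℤ) ∣ s
  · have hpF : ¬ (p : ℤ) ∣ F := fun h => hpl (hl hps h)
    refine Dvd.dvd.mul_left ?_ _
    have := Fact.mk hp
    have hF : F ≠ 0 := by rintro rfl; exact hpF (dvd_zero _)
    have hd : d ≠ 0 := by rintro rfl; exact hpd (dvd_zero _)
    have hpow : ∀ (a : ℤ) (m : ℕ), padicValInt p (a ^ m) = m * padicValInt p a := fun a m => by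
      rw [padicValInt, Int.natAbs_pow, padicValNat.pow, padicValInt]
    have hv := congrArg (padicValInt p) heq
    rw [padicValInt.mul (pow_ne_zero _ hs) hF, padicValInt.mul hd (pow_ne_zero _ hw),
      hpow, hpow, padicValInt.eq_zero_of_not_dvd hpF,
      padicValInt.eq_zero_of_not_dvd hpd] at hv
    set v := padicValInt p s with hvdef
    have hv0 : v ≠ 0 := by
      intro h
      have := (padicValInt_dvd_iff (p := p) 1 s).mp (by simpa using hps)
      omega
    have h1 : n ∣ v * (n - i) := ⟨padicValInt p w, by rw [mul_comm]; omega⟩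
    have h2 : n ∣ v * i := by
      have h3 : v * (n - i) + v * i = v * n := by rw [← mul_add]; congr 1; omega
      exact (Nat.dvd_add_right h1).mp (h3 ▸ Dvd.intro_left v rfl)
    have h4 : n ∣ v * Nat.gcd n i := by
      rw [← Nat.gcd_mul_left]
      exact Nat.dvd_gcd (Dvd.intro_left v rfl) h2
    have h5 : n ≤ v * Nat.gcd n i := Nat.le_of_dvd (by positivity) h4
    have h6 : (p : ℤ) ^ v ∣ s := (padicValInt_dvd_iff (p := p) v s).mpr (Or.inr le_rfl)
    refine (pow_dvd_pow _ h5).trans ?_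
    rw [pow_mul]
    exact pow_dvd_pow_of_dvd h6 _
  · have hpF : (p : ℤ) ∣ F := (hp'.dvd_or_dvd hpsF).resolve_left hps
    have h1 : (p : ℤ) ∣ w := by
      have : (p : ℤ) ∣ d * w ^ n := heq ▸ hpF.mul_left _
      exact hp'.dvd_of_dvd_pow ((hp'.dvd_or_dvd this).resolve_left hpd)
    have h2 : (p : ℤ) ^ n ∣ s ^ (n - i) * F := heq ▸ (pow_dvd_pow_of_dvd h1 n).mul_left _
    have h3 : (p : ℤ) ^ n ∣ F :=
      hp'.pow_dvd_of_dvd_mul_left n (fun h => hps (hp'.dvd_of_dvd_pow h)) h2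
    exact (h3.mul_left _).mul_right _

lemma height_le_of_bounds {H ρ C₁ C₂ x e ε : ℝ} {n D g : ℕ} (hn : 2 ≤ n) (hH : 1 ≤ H) (hx : 1 ≤ x)
    (hC₁ : 0 < C₁) (hC₂ : 0 < C₂) (he : 0 < e) (hε : 0 < ε)
    (heq : ((n : ℝ) - 1) * e = n * (D - 1) - D - g)
    (h₁ : H ^ ((D : ℝ) - 1 - (n - 1) * e * ε / (n * (1 / e + ε))) ≤ C₁ * ρ)
    (h₂ : ρ ^ n ≤ C₂ * x ^ (n - 1) * H ^ (D + g)) :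
    H ≤ (C₁ ^ n * C₂) ^ ((1 / e + ε) / (n - 1)) * x ^ (1 / e + ε) := by
  have hH0 : 0 < H := by linarith
  have hx0 : 0 < x := by linarith
  have hn1 : (0 : ℝ) < (n : ℝ) - 1 := by
    have : (2 : ℝ) ≤ n := by exact_mod_cast hn
    linarith
  have hn0 : (n : ℝ) ≠ 0 := by linarith
  set σ := 1 / e + ε with hσ
  have hσ0 : 0 < σ := by positivity
  set ε' := ((n : ℝ) - 1) * e * ε / (n * σ) with hε'
  have h3 : H ^ (((D : ℝ) - 1 - ε') * n) ≤ C₁ ^ n * C₂ * x ^ (n - 1) * H ^ (D + g) := by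
    rw [Real.rpow_mul hH0.le, Real.rpow_natCast]
    calc (H ^ ((D : ℝ) - 1 - ε')) ^ n ≤ (C₁ * ρ) ^ n := by gcongr
      _ = C₁ ^ n * ρ ^ n := mul_pow _ _ _
      _ ≤ C₁ ^ n * (C₂ * x ^ (n - 1) * H ^ (D + g)) := by gcongr
      _ = _ := by ring
  have hexp : ((D : ℝ) - 1 - ε') * n = (n - 1) / σ + ((D + g : ℕ) : ℝ) := by
    have h4 : (n : ℝ) * ε' = (n - 1) * e - (n - 1) / σ := by
      have h5 : e * ε = e * σ - 1 := by rw [hσ]; field_simp; ring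
      rw [hε', mul_assoc ((n : ℝ) - 1), h5]
      field_simp
    push_cast
    linarith
  rw [hexp, Real.rpow_add hH0, Real.rpow_natCast] at h3
  have h6 := le_of_mul_le_mul_right h3 (by positivity)
  have h7 := Real.rpow_le_rpow (by positivity) h6 (by positivity : 0 ≤ σ / (n - 1))
  rw [← Real.rpow_mul hH0.le, Real.mul_rpow (by positivity) (by positivity),
    ← Real.rpow_natCast x, ← Real.rpow_mul hx0.le, Nat.cast_sub (by omega), Nat.cast_one,
    mul_div_cancel₀ _ hn1.ne', div_mul_div_comm, mul_comm ((n : ℝ) - 1) σ, div_self (by positivity),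
    Real.rpow_one] at h7
  exact h7

/-- Granville: assuming the abc conjecture, rational points on twists
`d·y^n = f(x)` have bounded height in terms of `d`. -/
theorem stmt_1 (habc : ABCConjecture) (n : ℕ) (hn : 2 ≤ n) (f : Polynomial ℤ)
    (hsf : Squarefree (f.map (Int.castRingHom ℚ)))
    (k i : ℕ) (hi1 : 1 ≤ i) (hin : i ≤ n) (hdeg : f.natDegree = n * k + i)
    (e : ℝ)
    (he : e = ((n : ℝ) * k + i - 1) - ((Nat.gcd n i : ℝ) + 1) / ((n : ℝ) - 1))
    (hepos : 0 < e) :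
    ∀ ε : ℝ, 0 < ε → ∃ K : ℝ, 0 < K ∧
      ∀ d : ℤ, NthPowerFree n d →
      ∀ r s : ℤ, 1 ≤ s → IsCoprime r s →
      ∀ y : ℚ, (d : ℚ) * y ^ n = Polynomial.aeval ((r : ℚ) / (s : ℚ)) f →
        ((|r| : ℤ) : ℝ) ≤ K * ((|d| : ℤ) : ℝ) ^ (1 / e + ε) ∧
        ((|s| : ℤ) : ℝ) ≤ K * ((|d| : ℤ) : ℝ) ^ (1 / e + ε) := by
  intro ε hε
  have hD : f.natDegree ≠ 0 := by omega
  have hf0 : f ≠ 0 := by rintro rfl; simp at hD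
  have hlc : f.leadingCoeff ≠ 0 := leadingCoeff_ne_zero.mpr hf0
  have hn1 : (0 : ℝ) < (n : ℝ) - 1 := by
    have : (2 : ℝ) ≤ n := by exact_mod_cast hn
    linarith
  have hn0 : (0 : ℝ) < n := by linarith
  have heq : ((n : ℝ) - 1) * e = n * ((f.natDegree : ℝ) - 1) - f.natDegree - Nat.gcd n i := by
    rw [he, hdeg]
    push_cast
    field_simp
    ring
  obtain ⟨C₁, hC₁, hrad⟩ := habc.exists_rpow_le_intRadical f hsf
    (((n : ℝ) - 1) * e * ε / (n * (1 / e + ε))) (by positivity)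
  obtain ⟨C₂, hC₂, hF⟩ := exists_abs_homogenizedEval_le f
  obtain ⟨C₃, hC₃, hroot⟩ := exists_height_le_of_root f hf0
  have hlcr : (0 : ℝ) < |(f.leadingCoeff : ℝ)| := abs_pos.mpr (Int.cast_ne_zero.mpr hlc)
  set C₄ := |(f.leadingCoeff : ℝ)| ^ n * C₂
  have hC₄ : 0 < C₄ := by positivity
  refine ⟨(C₁ ^ n * C₄) ^ ((1 / e + ε) / (n - 1)) + C₃, by positivity,
    fun d hd r s hs hrs y hy => ?_⟩
  have hs0 : s ≠ 0 := by omega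
  have hsQ : (s : ℚ) ≠ 0 := Int.cast_ne_zero.mpr hs0
  set H := max |(r : ℝ)| |(s : ℝ)| with hH
  have hH1 : 1 ≤ H := by
    refine le_trans ?_ (le_max_right _ _)
    exact_mod_cast Int.one_le_abs hs0
  have hx1 : (1 : ℝ) ≤ |(d : ℝ)| := by exact_mod_cast Int.one_le_abs hd.1
  have hxe : 1 ≤ |(d : ℝ)| ^ (1 / e + ε) := Real.one_le_rpow hx1 (by positivity)
  suffices hmain : H ≤ ((C₁ ^ n * C₄) ^ ((1 / e + ε) / (n - 1)) + C₃) *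
      |(d : ℝ)| ^ (1 / e + ε) by
    push_cast
    exact ⟨(le_max_left _ _).trans hmain, (le_max_right _ _).trans hmain⟩
  have hC₅ : 0 < (C₁ ^ n * C₄) ^ ((1 / e + ε) / (n - 1)) := by positivity
  have hcast := cast_homogenizedEval f r s hs0
  by_cases hF0 : homogenizedEval f r s = 0
  · have h0 : aeval ((r : ℚ) / s) f = 0 := by
      rw [hF0, Int.cast_zero] at hcast
      exact (mul_eq_zero.mp hcast.symm).resolve_left (pow_ne_zero _ hsQ)
    have := hroot r s hs hrs h0
    nlinarith
  have hradH := hrad r s hs hrs hF0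
  set F := homogenizedEval f r s with hFdef
  have hw : (d : ℚ) * (y * (s : ℚ) ^ (k + 1)) ^ n = ((s ^ (n - i) * F : ℤ) : ℚ) := by
    have hexp : n * (k + 1) = (n - i) + f.natDegree := by rw [hdeg, mul_add]; omega
    push_cast
    rw [hcast, ← hy, mul_pow, ← pow_mul, mul_comm (k + 1) n, hexp, pow_add]
    ring
  obtain ⟨w, hwu⟩ := hd.exists_int_eq hw
  rw [hwu] at hw
  have hw' : s ^ (n - i) * F = d * w ^ n := by exact_mod_cast hw.symm
  have hw0 : w ≠ 0 := by
    rintro rfl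
    rw [zero_pow (by omega), mul_zero] at hw'
    exact mul_ne_zero (pow_ne_zero _ hs0) hF0 hw'
  set Y := f.leadingCoeff ^ n * d ^ (n - 1) * F * s ^ (Nat.gcd n i) with hY
  have hY0 : Y ≠ 0 := mul_ne_zero (mul_ne_zero (mul_ne_zero (pow_ne_zero _ hlc)
    (pow_ne_zero _ hd.1)) hF0) (pow_ne_zero _ hs0)
  have hdvd : IntRadical (s * F) ^ n ∣ Y.natAbs := by
    refine intRadical_pow_dvd fun p hp h => ?_
    have h1 := prime_pow_dvd_of_twist hn hi1 hin (l := f.leadingCoeff) hs0 hw0 hw' hp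
      (fun h1 h2 => ?_) h
    · exact Int.natCast_dvd.mp (by exact_mod_cast h1)
    · have hp' : Prime (p : ℤ) := Nat.prime_iff_prime_int.mp hp
      obtain ⟨E, hE, -⟩ := exists_homogenizedEval_eq_lead_add f
      rw [hFdef, hE] at h2
      have h3 := (Int.dvd_add_left (h1.mul_right (E r s))).mp h2
      refine (hp'.dvd_or_dvd h3).resolve_right fun h4 => ?_
      exact hp'.not_isUnit (hrs.isUnit_of_dvd' (hp'.dvd_of_dvd_pow h4) h1)
  have hle : (IntRadical (s * F) : ℝ) ^ n ≤
      C₄ * |(d : ℝ)| ^ (n - 1) * H ^ (f.natDegree + Nat.gcd n i) := by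
    have h1 : (IntRadical (s * F) : ℝ) ^ n ≤ |(Y : ℝ)| := by
      have := Nat.le_of_dvd (Int.natAbs_pos.mpr hY0) hdvd
      rw [← Int.cast_abs, ← Nat.cast_natAbs]
      exact_mod_cast this
    refine h1.trans ?_
    rw [hY]
    push_cast
    rw [abs_mul, abs_mul, abs_mul, abs_pow, abs_pow, abs_pow]
    have h2 := hF r s H (le_max_left _ _) (le_max_right _ _)
    have h3 : |(s : ℝ)| ≤ H := le_max_right _ _
    calc _ ≤ |(f.leadingCoeff : ℝ)| ^ n * |(d : ℝ)| ^ (n - 1) * (C₂ * H ^ f.natDegree) *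
          H ^ (Nat.gcd n i) := by gcongr
      _ = _ := by rw [pow_add]; ring
  have hfin := height_le_of_bounds hn hH1 hx1 hC₁ hC₄ hepos hε heq hradH hle
  nlinarith
end

section
/- Assume the abc conjecture. Let n ≥ 2 be an integer and let f ∈ ℤ[X] be squarefree (in ℚ[X]) with deg f > (4n−2)/(n−1). Then there exist a real number a with a < 1 and a constant K > 0 such that for all real X ≥ 2, the number of n-th power free integers d with |d| ≤ X for which there exist x, y ∈ ℚ with y ≠ 0 and d·y^n = f(x) is at most K·X^a. -/
open Polynomial

/-- The multiplicative height of a rational number. -/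
def ratHeight (x : ℚ) : ℕ := max x.num.natAbs x.den

lemma one_le_ratHeight (x : ℚ) : 1 ≤ ratHeight x := le_max_of_le_right x.pos

lemma den_le_ratHeight (x : ℚ) : x.den ≤ ratHeight x := le_max_right _ _

lemma abs_num_le_ratHeight (x : ℚ) : |x.num| ≤ ratHeight x := by
  rw [Int.abs_eq_natAbs]
  exact_mod_cast le_max_left _ _

section Radical

lemma intRadical_le_of_forall_prime {a b : ℤ} (hb : b ≠ 0)
    (h : ∀ p : ℕ, p.Prime → (p : ℤ) ∣ a → (p : ℤ) ∣ b) : IntRadical a ≤ IntRadical b := by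
  refine Finset.prod_le_prod_of_subset_of_one_le' ?_
    fun _ hp _ => (Nat.prime_of_mem_primeFactors hp).one_le
  intro p hp
  have hp' := Nat.prime_of_mem_primeFactors hp
  rw [Nat.mem_primeFactors]
  exact ⟨hp', Int.natCast_dvd.1 (h p hp' (Int.natCast_dvd.2 (Nat.dvd_of_mem_primeFactors hp))),
    Int.natAbs_ne_zero.2 hb⟩

lemma intRadical_mul_le {a b : ℤ} (ha : a ≠ 0) (hb : b ≠ 0) :
    IntRadical (a * b) ≤ IntRadical a * IntRadical b := by
  unfold IntRadical
  rw [Int.natAbs_mul, Nat.primeFactors_mul (Int.natAbs_ne_zero.2 ha) (Int.natAbs_ne_zero.2 hb),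
    ← Finset.prod_union_inter]
  refine Nat.le_mul_of_pos_right _ (Finset.prod_pos fun p hp => ?_)
  exact (Nat.prime_of_mem_primeFactors (Finset.mem_inter.1 hp).1).pos

lemma intRadical_le_natAbs {a : ℤ} (ha : a ≠ 0) : IntRadical a ≤ a.natAbs :=
  Nat.le_of_dvd (Int.natAbs_pos.2 ha) (Nat.prod_primeFactors_dvd _)

end Radical

section Evaluation

/-- The homogenization of `p` evaluated at the numerator and the denominator of `x`. -/
def homEval (p : ℤ[X]) (x : ℚ) : ℤ :=
  ∑ i ∈ Finset.range (p.natDegree + 1), p.coeff i * x.num ^ i * (x.den : ℤ) ^ (p.natDegree - i)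

lemma cast_homEval (p : ℤ[X]) (x : ℚ) :
    (homEval p x : ℚ) = (x.den : ℚ) ^ p.natDegree * (p.map (Int.castRingHom ℚ)).eval x := by
  have hd : (x.den : ℚ) ≠ 0 := by exact_mod_cast x.den_nz
  rw [homEval, eval_map, eval₂_eq_sum_range, Finset.mul_sum]
  push_cast
  refine Finset.sum_congr rfl fun i hi => ?_
  have hi' : i ≤ p.natDegree := Nat.lt_succ_iff.1 (Finset.mem_range.1 hi)
  conv_rhs => rw [← Rat.num_div_den x]
  rw [← Nat.sub_add_cancel hi', pow_add, div_pow, Nat.add_sub_cancel]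
  simp only [eq_intCast, Rat.num_div_den]
  field_simp

lemma abs_sum_monomials_le (a : ℕ → ℤ) (x : ℚ) {k N : ℕ} (hk : k ≤ N + 1) :
    |∑ i ∈ Finset.range k, a i * x.num ^ i * (x.den : ℤ) ^ (N - i)|
      ≤ (∑ i ∈ Finset.range k, |a i|) * (ratHeight x : ℤ) ^ N := by
  refine (Finset.abs_sum_le_sum_abs _ _).trans ?_
  rw [Finset.sum_mul]
  refine Finset.sum_le_sum fun i hi => ?_
  have hi' : i ≤ N := by have := Finset.mem_range.1 hi; omega
  rw [abs_mul, abs_mul, abs_pow, abs_pow, mul_assoc]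
  refine mul_le_mul_of_nonneg_left ?_ (abs_nonneg _)
  obtain ⟨j, rfl⟩ := Nat.exists_eq_add_of_le hi'
  rw [pow_add, Nat.add_sub_cancel_left]
  have h2 : |(x.den : ℤ)| ≤ ratHeight x := by
    rw [Nat.abs_cast]; exact_mod_cast den_le_ratHeight x
  have h1 := abs_num_le_ratHeight x
  gcongr

lemma exists_clear_denominators (φ : ℚ[X]) :
    ∃ M : ℤ, 0 < M ∧ ∃ p : ℤ[X], p.map (Int.castRingHom ℚ) = C (M : ℚ) * φ := by
  obtain ⟨b, hb, h⟩ := IsLocalization.integerNormalization_spec (nonZeroDivisors ℤ) φ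
  have hb0 : b ≠ 0 := nonZeroDivisors.ne_zero hb
  refine ⟨b * b, mul_self_pos.2 hb0, C b *
    IsLocalization.integerNormalization (nonZeroDivisors ℤ) φ, ?_⟩
  rw [Polynomial.map_mul, ← algebraMap_int_eq, h, map_C, ← Int.cast_smul_eq_zsmul ℚ, smul_eq_C_mul,
    ← mul_assoc, ← C_mul]
  simp

lemma natDegree_eq_of_map_eq {φ : ℚ[X]} {M : ℤ} (hM : 0 < M) {p : ℤ[X]}
    (hp : p.map (Int.castRingHom ℚ) = C (M : ℚ) * φ) : p.natDegree = φ.natDegree := by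
  rw [← natDegree_map_eq_of_injective (RingHom.injective_int (Int.castRingHom ℚ)) p, hp,
    natDegree_C_mul (by exact_mod_cast hM.ne')]

/-- The value of a polynomial of degree `N` at `r / s` becomes an integer of size `O(H ^ N)` after
multiplication by a constant and by `s ^ N`. -/
lemma exists_eval_eq_int (φ : ℚ[X]) :
    ∃ M : ℤ, 0 < M ∧ ∃ B : ℕ, ∀ x : ℚ, ∃ U : ℤ,
      (M : ℚ) * (x.den : ℚ) ^ φ.natDegree * φ.eval x = U ∧
        U.natAbs ≤ B * ratHeight x ^ φ.natDegree := by
  obtain ⟨M, hM, p, hp⟩ := exists_clear_denominators φ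
  refine ⟨M, hM, (∑ i ∈ Finset.range (p.natDegree + 1), |p.coeff i|).natAbs, fun x =>
    ⟨homEval p x, ?_, ?_⟩⟩
  · rw [cast_homEval, hp, natDegree_eq_of_map_eq hM hp]
    simp only [eval_mul, eval_C]
    ring
  · have := abs_sum_monomials_le p.coeff x (le_refl (p.natDegree + 1))
    zify
    rw [abs_of_nonneg (a := ∑ i ∈ Finset.range (p.natDegree + 1), |p.coeff i|) (by positivity),
      ← natDegree_eq_of_map_eq hM hp]
    exact this

lemma isCoprime_num_den (q : ℚ) : IsCoprime q.num (q.den : ℤ) :=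
  Int.isCoprime_iff_nat_coprime.2 (by simpa using q.reduced)

lemma num_dvd_of_mul_eq {q : ℚ} {m U : ℤ} (h : (m : ℚ) * q = U) : q.num ∣ U := by
  have hd : (q.den : ℚ) ≠ 0 := by exact_mod_cast q.den_nz
  have h1 : m * q.num = U * q.den := by
    rw [← Rat.num_div_den q] at h
    field_simp at h
    rw [mul_comm U]
    exact_mod_cast h
  exact (isCoprime_num_den q).dvd_of_dvd_mul_right (h1 ▸ dvd_mul_left _ _)

lemma den_dvd_of_mul_eq {q : ℚ} {m U : ℤ} (h : (m : ℚ) * q = U) : (q.den : ℤ) ∣ m := by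
  have hd : (q.den : ℚ) ≠ 0 := by exact_mod_cast q.den_nz
  have h1 : m * q.num = U * q.den := by
    rw [← Rat.num_div_den q] at h
    field_simp at h
    rw [mul_comm U]
    exact_mod_cast h
  exact (isCoprime_num_den q).symm.dvd_of_dvd_mul_right (h1.symm ▸ dvd_mul_left _ _)

lemma exists_num_eval_le (φ : ℚ[X]) :
    ∃ B : ℕ, ∀ x : ℚ, φ.eval x ≠ 0 →
      (φ.eval x).num.natAbs ≤ B * ratHeight x ^ φ.natDegree := by
  obtain ⟨M, hM, B, h⟩ := exists_eval_eq_int φ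
  refine ⟨B, fun x hx => ?_⟩
  obtain ⟨U, hU, hUB⟩ := h x
  have hd : (x.den : ℚ) ≠ 0 := by exact_mod_cast x.den_nz
  have hU0 : U ≠ 0 := by
    rintro rfl
    have : (M : ℚ) ≠ 0 := by exact_mod_cast hM.ne'
    simp_all
  refine le_trans (Nat.le_of_dvd (Int.natAbs_pos.2 hU0) (Int.natAbs_dvd_natAbs.2 ?_)) hUB
  exact num_dvd_of_mul_eq (m := M * (x.den : ℤ) ^ φ.natDegree) (by exact_mod_cast hU)

lemma exists_den_eval_dvd (φ : ℚ[X]) :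
    ∃ M : ℤ, 0 < M ∧ ∀ x : ℚ, ((φ.eval x).den : ℤ) ∣ M * (x.den : ℤ) ^ φ.natDegree := by
  obtain ⟨M, hM, B, h⟩ := exists_eval_eq_int φ
  refine ⟨M, hM, fun x => ?_⟩
  obtain ⟨U, hU, -⟩ := h x
  exact den_dvd_of_mul_eq (U := U) (by exact_mod_cast hU)

/-- Polynomial maps of degree `N` raise heights at least to the power `N`, up to a constant. -/
lemma exists_ratHeight_pow_le (φ : ℚ[X]) (hφ : 0 < φ.natDegree) :
    ∃ B : ℕ, ∀ x : ℚ, ratHeight x ^ φ.natDegree ≤ B * ratHeight (φ.eval x) := by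
  obtain ⟨M, hM, p, hp⟩ := exists_clear_denominators φ
  have hdeg := natDegree_eq_of_map_eq hM hp
  obtain ⟨N, hN⟩ : ∃ N, p.natDegree = N + 1 := ⟨p.natDegree - 1, by omega⟩
  set A : ℤ := p.coeff (N + 1) with hA
  have hA0 : A ≠ 0 := by
    rw [hA, ← hN]
    exact leadingCoeff_ne_zero.2 (by rintro rfl; simp at hN)
  set S : ℤ := ∑ i ∈ Finset.range (N + 1), |p.coeff i| + 1 with hS
  have hS1 : 1 ≤ S := le_add_of_nonneg_left (by positivity)
  -- the two parts of the homogenized polynomial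
  have key : ∀ x : ℚ, ∃ W : ℤ, |W| ≤ S * (ratHeight x : ℤ) ^ N ∧
      M * (φ.eval x).num * (x.den : ℤ) ^ (N + 1)
        = (A * x.num ^ (N + 1) + x.den * W) * (φ.eval x).den := by
    intro x
    refine ⟨∑ i ∈ Finset.range (N + 1), p.coeff i * x.num ^ i * (x.den : ℤ) ^ (N - i),
      (abs_sum_monomials_le p.coeff x le_rfl).trans ?_, ?_⟩
    · gcongr
      exact le_add_of_nonneg_right zero_le_one
    have h1 : homEval p x = A * x.num ^ (N + 1) + x.den *
        ∑ i ∈ Finset.range (N + 1), p.coeff i * x.num ^ i * (x.den : ℤ) ^ (N - i) := by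
      rw [homEval, hN, Finset.sum_range_succ, add_comm, Finset.mul_sum]
      congr 1
      · simp [hA]
      · refine Finset.sum_congr rfl fun i hi => ?_
        have : N + 1 - i = N - i + 1 := by have := Finset.mem_range.1 hi; omega
        rw [this, pow_succ]
        ring
    rw [← h1]
    have h2 := cast_homEval p x
    rw [hp, hN, eval_mul, eval_C] at h2
    have hd : ((φ.eval x).den : ℚ) ≠ 0 := by exact_mod_cast (φ.eval x).den_nz
    have h3 : φ.eval x * (φ.eval x).den = (φ.eval x).num := Rat.mul_den_eq_num _
    have : (M * (φ.eval x).num * (x.den : ℤ) ^ (N + 1) : ℚ)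
        = (homEval p x : ℚ) * (φ.eval x).den := by
      rw [h2, ← h3]; push_cast; ring
    exact_mod_cast this
  -- the denominator
  have hden : ∀ x : ℚ, (x.den : ℤ) ^ (N + 1) ≤ |A| ^ (N + 2) * (φ.eval x).den := by
    intro x
    obtain ⟨W, -, hW⟩ := key x
    set s : ℤ := (x.den : ℤ) with hs
    have hs0 : s ≠ 0 := by rw [hs]; exact_mod_cast x.den_nz
    obtain ⟨g, A', s', hg, hco, hA', hs'⟩ : ∃ g A' s' : ℤ, g ≠ 0 ∧ IsCoprime A' s' ∧
        A = g * A' ∧ s = g * s' := by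
      obtain ⟨g, A', s', hg, hco, hA', hs'⟩ := Int.exists_gcd_one' (Int.gcd_pos_of_ne_zero_left s hA0)
      exact ⟨g, A', s', by exact_mod_cast hg.ne', Int.isCoprime_iff_gcd_eq_one.2 hco,
        by rw [hA', mul_comm], by rw [hs', mul_comm]⟩
    have hco2 : IsCoprime (s' ^ (N + 1)) (A' * x.num ^ (N + 1) + s' * W) := by
      apply IsCoprime.pow_left
      rw [isCoprime_comm]
      apply IsCoprime.add_mul_left_left
      refine IsCoprime.mul_left hco (IsCoprime.pow_left ?_)
      have : IsCoprime x.num s := isCoprime_num_den x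
      exact this.of_isCoprime_of_dvd_right ⟨g, by rw [hs']; ring⟩
    have hdvd : s' ^ (N + 1) ∣ g * (φ.eval x).den := by
      refine hco2.dvd_of_dvd_mul_left ?_
      refine ⟨M * (φ.eval x).num * g ^ (N + 1), ?_⟩
      rw [hA', hs'] at hW
      linear_combination (-1 : ℤ) * hW
    have hdvd2 : s ^ (N + 1) ∣ A ^ (N + 2) * (φ.eval x).den := by
      rw [hs', mul_pow, hA', mul_pow]
      obtain ⟨k, hk⟩ := hdvd
      exact ⟨k * A' ^ (N + 2), by linear_combination (g ^ (N + 1) * A' ^ (N + 2)) * hk⟩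
    have := Int.le_of_dvd ?_ ((dvd_abs _ _).2 hdvd2)
    · rwa [abs_mul, abs_pow, Nat.abs_cast] at this
    · exact abs_pos.2 (mul_ne_zero (pow_ne_zero _ hA0) (by exact_mod_cast (φ.eval x).den_nz))
  refine ⟨(((2 * S + 1) ^ (N + 1) + 2 * M) * |A| ^ (N + 2)).natAbs, fun x => ?_⟩
  rw [← hdeg, hN]
  zify
  rw [abs_of_nonneg (by positivity)]
  have hAp : 0 ≤ |A| ^ (N + 2) := by positivity
  have hs1 : (1 : ℤ) ≤ x.den := by exact_mod_cast x.pos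
  have ht := hden x
  rcases le_or_gt |x.num| (2 * S * x.den) with hsmall | hbig
  · have h1 : (ratHeight x : ℤ) ≤ (2 * S + 1) * x.den := by
      rw [ratHeight]
      push_cast
      rw [max_le_iff]
      constructor <;> nlinarith
    calc (ratHeight x : ℤ) ^ (N + 1) ≤ ((2 * S + 1) * x.den) ^ (N + 1) := by gcongr
      _ = (2 * S + 1) ^ (N + 1) * (x.den : ℤ) ^ (N + 1) := mul_pow _ _ _
      _ ≤ (2 * S + 1) ^ (N + 1) * (|A| ^ (N + 2) * (φ.eval x).den) := by gcongr
      _ ≤ (2 * S + 1) ^ (N + 1) * (|A| ^ (N + 2) * ratHeight (φ.eval x)) := by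
        gcongr; exact den_le_ratHeight _
      _ ≤ _ := by
        rw [add_mul, add_mul, ← mul_assoc]
        exact le_add_of_nonneg_right (by positivity)
  · obtain ⟨W, hWS, hW⟩ := key x
    have hH : (ratHeight x : ℤ) = |x.num| := by
      rw [ratHeight]
      push_cast
      exact max_eq_left (by nlinarith)
    rw [hH] at hWS ⊢
    have h1 : 2 * |x.den * W| ≤ |x.num| ^ (N + 1) := by
      rw [abs_mul, Nat.abs_cast]
      calc 2 * (x.den * |W|) ≤ 2 * (x.den * (S * |x.num| ^ N)) := by gcongr
        _ = (2 * S * x.den) * |x.num| ^ N := by ring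
        _ ≤ |x.num| * |x.num| ^ N := by gcongr
        _ = _ := by ring
    have h2 : |x.num| ^ (N + 1) ≤ |A * x.num ^ (N + 1)| := by
      rw [abs_mul, abs_pow]
      exact le_mul_of_one_le_left (by positivity) (Int.one_le_abs hA0)
    have h3 : |x.num| ^ (N + 1) ≤ 2 * |A * x.num ^ (N + 1) + x.den * W| := by
      have := abs_sub_abs_le_abs_add (A * x.num ^ (N + 1)) (x.den * W)
      linarith
    have ht0 : (0 : ℤ) < (φ.eval x).den := by exact_mod_cast (φ.eval x).pos
    have h4 : |x.num| ^ (N + 1) * (φ.eval x).den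
        ≤ 2 * M * |A| ^ (N + 2) * ratHeight (φ.eval x) * (φ.eval x).den := by
      calc |x.num| ^ (N + 1) * (φ.eval x).den
          ≤ 2 * |A * x.num ^ (N + 1) + x.den * W| * (φ.eval x).den := by gcongr
        _ = 2 * |M * (φ.eval x).num * (x.den : ℤ) ^ (N + 1)| := by
          rw [hW, abs_mul, Nat.abs_cast]; ring
        _ = 2 * (M * |(φ.eval x).num| * (x.den : ℤ) ^ (N + 1)) := by
          rw [abs_mul, abs_mul, abs_of_pos hM, abs_pow, Nat.abs_cast]
        _ ≤ 2 * (M * ratHeight (φ.eval x) * (|A| ^ (N + 2) * (φ.eval x).den)) := by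
          gcongr
          exact abs_num_le_ratHeight _
        _ = _ := by ring
    refine (le_of_mul_le_mul_right h4 ht0).trans ?_
    gcongr
    exact le_add_of_nonneg_left (by positivity)

end Evaluation

section Ramification

/-- If the finite set `T` contains all the finite branch points of the polynomial map `f` of
degree `N`, then at most `N * #T - (N - 1)` points lie above `T`. -/
lemma card_add_natDegree_derivative_le {K : Type*} [Field K] [CharZero K] [IsAlgClosed K]
    {f : K[X]} (hf : 0 < f.natDegree) {T B : Finset K} (hBT : ∀ β ∈ B, f.eval β ∈ T)
    (hbranch : ∀ β, f.derivative.eval β = 0 → β ∈ B) :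
    B.card + (f.natDegree - 1) ≤ f.natDegree * T.card := by
  classical
  have hf0 : f.derivative ≠ 0 := by
    intro h
    exact hf.ne' (derivative_eq_zero.1 h)
  have hne : ∀ t, f - C t ≠ 0 := by
    intro t h
    rw [sub_eq_zero.1 h, natDegree_C] at hf
    exact hf.false
  set Q : K[X] := ∏ t ∈ T, (f - C t) with hQ
  have hQ0 : Q ≠ 0 := Finset.prod_ne_zero_iff.2 fun t _ => hne t
  have hQdeg : Q.natDegree = f.natDegree * T.card := by
    rw [hQ, natDegree_prod _ _ fun t _ => hne t, Finset.sum_congr rfl fun t _ => natDegree_sub_C]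
    simp [mul_comm]
  have hcount : ∀ β ∈ B, f.derivative.roots.count β + 1 ≤ Q.roots.count β := by
    intro β hβ
    rw [count_roots, count_roots]
    have hroot : (f - C (f.eval β)).IsRoot β := by simp
    have h1 := derivative_rootMultiplicity_of_root hroot
    have h2 := (rootMultiplicity_pos (hne (f.eval β))).2 hroot
    have h3 := rootMultiplicity_le_rootMultiplicity_of_dvd hQ0
      (Finset.dvd_prod_of_mem (fun t => f - C t) (hBT β hβ)) β
    rw [derivative_sub, derivative_C, sub_zero] at h1
    omega
  have hsub : B ⊆ Q.roots.toFinset := fun β hβ =>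
    Multiset.mem_toFinset.2 (Multiset.count_pos.1 (by have := hcount β hβ; omega))
  have hder : ∑ β ∈ B, f.derivative.roots.count β = f.natDegree - 1 := by
    rw [Multiset.sum_count_eq_card fun β hβ => hbranch β (isRoot_of_mem_roots hβ),
      ← (IsAlgClosed.splits f.derivative).natDegree_eq_card_roots, natDegree_derivative]
  calc B.card + (f.natDegree - 1) = ∑ β ∈ B, (f.derivative.roots.count β + 1) := by
        rw [Finset.sum_add_distrib, hder, Finset.sum_const, smul_eq_mul, mul_one, add_comm]
    _ ≤ ∑ β ∈ B, Q.roots.count β := Finset.sum_le_sum hcount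
    _ ≤ ∑ β ∈ Q.roots.toFinset, Q.roots.count β := Finset.sum_le_sum_of_subset hsub
    _ = Q.roots.card := Multiset.toFinset_sum_count_eq _
    _ ≤ Q.natDegree := card_roots' _
    _ = _ := hQdeg

/-- The number of distinct complex roots of a rational polynomial. -/
noncomputable def numRoots (g : ℚ[X]) : ℕ := (g.aroots ℂ).toFinset.card

lemma numRoots_comp_add_le {φ ψ : ℚ[X]} (hφ : 0 < φ.natDegree) (hψ : ψ ≠ 0)
    (hbranch : ∀ β : ℂ, aeval β φ.derivative = 0 → aeval (aeval β φ) ψ = 0) :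
    numRoots (ψ.comp φ) + (φ.natDegree - 1) ≤ φ.natDegree * numRoots ψ := by
  have hcomp : ψ.comp φ ≠ 0 := by
    intro h
    rcases comp_eq_zero_iff.1 h with h | ⟨-, h⟩
    · exact hψ h
    · rw [h, natDegree_C] at hφ
      exact hφ.false
  have h := card_add_natDegree_derivative_le (f := φ.map (algebraMap ℚ ℂ))
    (T := (ψ.aroots ℂ).toFinset) (B := ((ψ.comp φ).aroots ℂ).toFinset) (by rwa [natDegree_map])
    ?_ ?_
  · rwa [natDegree_map] at h
  · intro β hβ
    rw [Multiset.mem_toFinset, mem_aroots, aeval_comp] at hβ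
    rw [Multiset.mem_toFinset, mem_aroots, eval_map_algebraMap]
    exact ⟨hψ, hβ.2⟩
  · intro β hβ
    rw [derivative_map, eval_map_algebraMap] at hβ
    rw [Multiset.mem_toFinset, mem_aroots, aeval_comp]
    exact ⟨hcomp, hbranch β hβ⟩

end Ramification

section AbcBound

/-- The product of the primes at which `x` meets `∞` or a root of `g`. -/
def abcConductor (g : ℚ[X]) (x : ℚ) : ℕ := IntRadical (x.den * (g.eval x).num)

/-- The lower bound for the conductor of `x` predicted by the abc conjecture, relative to the set
consisting of `∞` and the roots of `g`. -/
def AbcBound (g : ℚ[X]) : Prop :=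
  ∀ ε : ℝ, 0 < ε → ∃ K : ℝ, 0 < K ∧ ∀ x : ℚ, g.eval x ≠ 0 →
    (ratHeight x : ℝ) ^ (numRoots g - 1) ≤ K * (abcConductor g x : ℝ) ^ (1 + ε)

lemma den_mul_num_ne_zero {x q : ℚ} (hq : q ≠ 0) : (x.den : ℤ) * q.num ≠ 0 :=
  mul_ne_zero (by exact_mod_cast x.den_nz) (Rat.num_ne_zero.2 hq)

lemma prime_dvd_mul_num {M U : ℤ} {q : ℚ} (h : (M : ℚ) * q = U) {p : ℕ} (hp : p.Prime)
    (hpU : (p : ℤ) ∣ U) : (p : ℤ) ∣ M ∨ (p : ℤ) ∣ q.num := by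
  have hd : (q.den : ℚ) ≠ 0 := by exact_mod_cast q.den_nz
  have h1 : M * q.num = U * q.den := by
    rw [← Rat.num_div_den q] at h
    field_simp at h
    rw [mul_comm U]
    exact_mod_cast h
  exact (Nat.prime_iff_prime_int.1 hp).dvd_or_dvd (h1 ▸ hpU.mul_right _)

lemma abcBound_X_mul_X_sub_one (habc : ABCConjecture) : AbcBound (X * (X - 1)) := by
  intro ε hε
  obtain ⟨K, hK, h⟩ := habc ε hε
  refine ⟨K, hK, fun x hx => ?_⟩
  have hroots : numRoots (X * (X - 1)) ≤ 2 := by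
    refine (Multiset.toFinset_card_le _).trans ((card_roots' _).trans ?_)
    rw [natDegree_map]
    compute_degree
  have hx' : x * (x - 1) ≠ 0 := by simpa using hx
  have hr : x.num ≠ 0 := Rat.num_ne_zero.2 (left_ne_zero_of_mul hx')
  have hs : (x.den : ℤ) ≠ 0 := by exact_mod_cast x.den_nz
  have hsr : (x.den : ℤ) - x.num ≠ 0 := by
    intro h0
    apply right_ne_zero_of_mul hx'
    have : x.num = x.den := by linarith
    rw [← Rat.num_div_den x, this]
    field_simp
    simp
  have hco := isCoprime_num_den x
  have hco1 : IsCoprime x.num ((x.den : ℤ) - x.num) := by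
    simpa [sub_eq_add_neg] using hco.add_mul_left_right (-1)
  have hco2 : IsCoprime ((x.den : ℤ) - x.num) x.den := by
    have := (hco.neg_left).add_mul_left_left 1
    simpa [sub_eq_add_neg, add_comm] using this
  have hmain := h x.num (x.den - x.num) x.den hr hsr hs hco1 hco hco2 (by ring)
  have hH : (ratHeight x : ℝ) ^ (numRoots (X * (X - 1)) - 1) ≤ ratHeight x := by
    refine (pow_le_pow_right₀ (by exact_mod_cast one_le_ratHeight x)
      (show numRoots (X * (X - 1)) - 1 ≤ 1 by omega)).trans (pow_one _).le
  have hmax : (ratHeight x : ℤ) ≤ max (max |x.num| |(x.den : ℤ) - x.num|) |(x.den : ℤ)| := by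
    rw [ratHeight]
    push_cast
    rw [Nat.abs_cast]
    exact max_le_max_right _ (le_max_left _ _)
  have hrad : IntRadical (x.num * (x.den - x.num) * x.den) ≤ abcConductor (X * (X - 1)) x := by
    refine intRadical_le_of_forall_prime (den_mul_num_ne_zero hx) fun p hp hdvd => ?_
    have hp' := Nat.prime_iff_prime_int.1 hp
    rcases hp'.dvd_or_dvd hdvd with h1 | h1
    · have h2 : (((x.den : ℤ) ^ 2 : ℤ) : ℚ) * eval x (X * (X - 1))
          = ((-(x.num * (x.den - x.num)) : ℤ) : ℚ) := by
        have h3 := Rat.mul_den_eq_num x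
        simp only [eval_mul, eval_X, eval_sub, eval_one]
        push_cast
        rw [← h3]
        ring
      rcases prime_dvd_mul_num h2 hp ((dvd_neg).2 h1) with h4 | h4
      · exact (hp'.dvd_of_dvd_pow h4).mul_right _
      · exact h4.mul_left _
    · exact h1.mul_right _
  calc (ratHeight x : ℝ) ^ (numRoots (X * (X - 1)) - 1) ≤ ratHeight x := hH
    _ ≤ ((max (max |x.num| |(x.den : ℤ) - x.num|) |(x.den : ℤ)| : ℤ) : ℝ) := by exact_mod_cast hmax
    _ ≤ _ := hmain
    _ ≤ _ := by gcongr

lemma AbcBound.comp {φ ψ : ℚ[X]} (h : AbcBound ψ) (hφ : 0 < φ.natDegree) (hψ : ψ ≠ 0)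
    (hbranch : ∀ β : ℂ, aeval β φ.derivative = 0 → aeval (aeval β φ) ψ = 0) :
    AbcBound (ψ.comp φ) := by
  intro ε hε
  obtain ⟨K, hK, hb⟩ := h ε hε
  obtain ⟨B, hB⟩ := exists_ratHeight_pow_le φ hφ
  obtain ⟨M, hM, hMd⟩ := exists_den_eval_dvd φ
  refine ⟨(B : ℝ) ^ (numRoots ψ - 1) * (K * (M : ℝ) ^ (1 + ε)) + 1, by positivity, fun x hx => ?_⟩
  have hx' : ψ.eval (φ.eval x) ≠ 0 := by rwa [eval_comp] at hx
  have hexp : numRoots (ψ.comp φ) - 1 ≤ φ.natDegree * (numRoots ψ - 1) := by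
    have h1 := numRoots_comp_add_le hφ hψ hbranch
    rw [Nat.mul_sub, mul_one]
    omega
  have hcond : abcConductor ψ (φ.eval x) ≤ M.natAbs * abcConductor (ψ.comp φ) x := by
    have hne : (x.den : ℤ) * (eval x (ψ.comp φ)).num ≠ 0 := den_mul_num_ne_zero hx
    calc abcConductor ψ (φ.eval x) ≤ IntRadical (M * (x.den * (eval x (ψ.comp φ)).num)) := by
          refine intRadical_le_of_forall_prime (mul_ne_zero hM.ne' hne) fun p hp hdvd => ?_
          have hp' := Nat.prime_iff_prime_int.1 hp
          rw [eval_comp]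
          rcases hp'.dvd_or_dvd hdvd with h1 | h1
          · rcases hp'.dvd_or_dvd (h1.trans (hMd x)) with h2 | h2
            · exact h2.mul_right _
            · exact ((hp'.dvd_of_dvd_pow h2).mul_right _).mul_left _
          · exact (h1.mul_left _).mul_left _
      _ ≤ IntRadical M * abcConductor (ψ.comp φ) x := intRadical_mul_le hM.ne' hne
      _ ≤ _ := Nat.mul_le_mul_right _ (intRadical_le_natAbs hM.ne')
  have hcond' : (abcConductor ψ (φ.eval x) : ℝ) ≤ M * abcConductor (ψ.comp φ) x := by
    have : ((M.natAbs : ℕ) : ℝ) = M := by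
      rw [Nat.cast_natAbs, abs_of_pos hM]
    rw [← this]
    exact_mod_cast hcond
  have hB' : (ratHeight x : ℝ) ^ φ.natDegree ≤ B * ratHeight (φ.eval x) := by exact_mod_cast hB x
  have hM0 : (0 : ℝ) ≤ M := by exact_mod_cast hM.le
  calc (ratHeight x : ℝ) ^ (numRoots (ψ.comp φ) - 1)
      ≤ (ratHeight x : ℝ) ^ (φ.natDegree * (numRoots ψ - 1)) :=
        pow_le_pow_right₀ (by exact_mod_cast one_le_ratHeight x) hexp
    _ = ((ratHeight x : ℝ) ^ φ.natDegree) ^ (numRoots ψ - 1) := pow_mul _ _ _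
    _ ≤ (B * ratHeight (φ.eval x)) ^ (numRoots ψ - 1) := by gcongr
    _ = (B : ℝ) ^ (numRoots ψ - 1) * (ratHeight (φ.eval x) : ℝ) ^ (numRoots ψ - 1) := mul_pow _ _ _
    _ ≤ (B : ℝ) ^ (numRoots ψ - 1) * (K * (abcConductor ψ (φ.eval x) : ℝ) ^ (1 + ε)) := by
      gcongr
      exact hb _ hx'
    _ ≤ (B : ℝ) ^ (numRoots ψ - 1) * (K * (M * abcConductor (ψ.comp φ) x : ℝ) ^ (1 + ε)) := by gcongr
    _ = (B : ℝ) ^ (numRoots ψ - 1) * (K * (M : ℝ) ^ (1 + ε)) *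
        (abcConductor (ψ.comp φ) x : ℝ) ^ (1 + ε) := by
      rw [Real.mul_rpow hM0 (by positivity)]
      ring
    _ ≤ _ := by
      gcongr
      linarith

end AbcBound

section Belyi

/-- The roots of `g` are among those of a polynomial satisfying the bound `AbcBound`. -/
def AbcDominated (g : ℚ[X]) : Prop :=
  ∃ h : ℚ[X], h ≠ 0 ∧ AbcBound h ∧ ∀ β : ℂ, aeval β g = 0 → aeval β h = 0

lemma AbcDominated.of_comp {g φ ψ : ℚ[X]} (h : AbcDominated ψ) (hφ : 0 < φ.natDegree)
    (hbranch : ∀ β : ℂ, aeval β φ.derivative = 0 → aeval (aeval β φ) ψ = 0)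
    (hg : ∀ β : ℂ, aeval β g = 0 → aeval (aeval β φ) ψ = 0) : AbcDominated g := by
  obtain ⟨k, hk0, hk, hψk⟩ := h
  refine ⟨k.comp φ, ?_, hk.comp hφ hk0 fun β hβ => hψk _ (hbranch β hβ), fun β hβ => ?_⟩
  · intro h0
    rcases comp_eq_zero_iff.1 h0 with h1 | ⟨-, h1⟩
    · exact hk0 h1
    · rw [h1, natDegree_C] at hφ
      exact hφ.false
  · rw [aeval_comp]
    exact hψk _ (hg β hβ)

lemma aeval_prod_X_sub_C_eq_zero_iff {A : Finset ℚ} {β : ℂ} :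
    aeval β (∏ a ∈ A, (X - C a)) = 0 ↔ ∃ a ∈ A, β = a := by
  simp [map_prod, Finset.prod_eq_zero_iff, sub_eq_zero]

lemma abcDominated_of_card_le_two (habc : ABCConjecture) {A : Finset ℚ} (hA : A.card ≤ 2) :
    AbcDominated (∏ a ∈ A, (X - C a)) := by
  obtain ⟨a, b, hab, hsub⟩ : ∃ a b : ℚ, a ≠ b ∧ A ⊆ {a, b} := by
    obtain ⟨B, hAB, hB⟩ := Infinite.exists_superset_card_eq A 2 hA
    obtain ⟨a, b, hab, rfl⟩ := Finset.card_eq_two.1 hB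
    exact ⟨a, b, hab, hAB⟩
  have hba : b - a ≠ 0 := sub_ne_zero.2 hab.symm
  have hbaC : (b : ℂ) - a ≠ 0 := by exact_mod_cast hba
  have hbase : AbcDominated (X * (X - 1)) :=
    ⟨_, mul_ne_zero X_ne_zero (X_sub_C_ne_zero 1), abcBound_X_mul_X_sub_one habc, fun _ h => h⟩
  refine hbase.of_comp (φ := C (b - a)⁻¹ * (X - C a)) ?_ ?_ ?_
  · rw [natDegree_C_mul (inv_ne_zero hba), natDegree_X_sub_C]
    exact one_pos
  · intro β hβ
    simp only [derivative_C_mul, derivative_X_sub_C, mul_one, aeval_C] at hβ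
    exact absurd hβ (by simpa using hbaC)
  · intro β hβ
    obtain ⟨c, hc, rfl⟩ := aeval_prod_X_sub_C_eq_zero_iff.1 hβ
    rcases Finset.mem_insert.1 (hsub hc) with rfl | hc
    · simp
    · rw [Finset.mem_singleton.1 hc]
      simp [inv_mul_cancel₀ hbaC]

/-- Belyi's reduction of the number of rational branch points. -/
lemma abcDominated_prod_X_sub_C (habc : ABCConjecture) (A : Finset ℚ) :
    AbcDominated (∏ a ∈ A, (X - C a)) := by
  classical
  induction hn : A.card using Nat.strong_induction_on generalizing A with
  | _ n ih =>
  rcases le_or_gt A.card 2 with hA | hA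
  · exact abcDominated_of_card_le_two habc hA
  have hne : A.Nonempty := Finset.card_pos.1 (by omega)
  set a := A.min' hne with ha
  set c := A.max' hne with hc
  obtain ⟨b, hb⟩ : ((A.erase a).erase c).Nonempty := by
    apply Finset.card_pos.1
    have h1 := Finset.pred_card_le_card_erase (s := A) (a := a)
    have h2 := Finset.pred_card_le_card_erase (s := A.erase a) (a := c)
    omega
  simp only [Finset.mem_erase] at hb
  obtain ⟨hbc, hba, hbA⟩ := hb
  have hab : a < b := lt_of_le_of_ne (A.min'_le b hbA) hba.symm
  have hbc : b < c := lt_of_le_of_ne (A.le_max' b hbA) hbc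
  have hq : 0 < (b - a) / (c - b) := div_pos (sub_pos.2 hab) (sub_pos.2 hbc)
  obtain ⟨m, k, hm⟩ : ∃ m k : ℕ, (b - a) * (k + 1) = (c - b) * (m + 1) := by
    set q := (b - a) / (c - b) with hqd
    have hnum : 0 < q.num := Rat.num_pos.2 hq
    refine ⟨q.num.toNat - 1, q.den - 1, ?_⟩
    have h1 : ((q.num.toNat - 1 : ℕ) : ℚ) + 1 = q.num := by
      have : (((q.num.toNat - 1 : ℕ) : ℤ) + 1) = q.num := by omega
      exact_mod_cast this
    have h2 : ((q.den - 1 : ℕ) : ℚ) + 1 = q.den := by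
      have : q.den - 1 + 1 = q.den := Nat.sub_add_cancel q.pos
      exact_mod_cast this
    rw [h1, h2, ← Rat.mul_den_eq_num q, hqd]
    have := (sub_pos.2 hbc).ne'
    field_simp
  set φ : ℚ[X] := (X - C a) ^ (m + 1) * (X - C c) ^ (k + 1) with hφ
  have hdeg : 0 < φ.natDegree := by
    rw [hφ, ((monic_X_sub_C a).pow _).natDegree_mul ((monic_X_sub_C c).pow _),
      natDegree_pow, natDegree_pow, natDegree_X_sub_C, natDegree_X_sub_C]
    omega
  have hac : φ.eval a = φ.eval c := by simp [hφ]
  have hlt : (A.image fun x => φ.eval x).card < n := by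
    rw [← hn]
    refine lt_of_le_of_ne Finset.card_image_le fun h => ?_
    have := Finset.card_image_iff.1 h (A.min'_mem hne) (A.max'_mem hne) hac
    exact (hab.trans hbc).ne this
  have hroot : ∀ x ∈ A, aeval (aeval (x : ℂ) φ)
      (∏ t ∈ A.image fun x => φ.eval x, (X - C t)) = 0 := fun x hx =>
    aeval_prod_X_sub_C_eq_zero_iff.2 ⟨φ.eval x, Finset.mem_image_of_mem _ hx, by
      simpa using aeval_algebraMap_apply_eq_algebraMap_eval (A := ℂ) x φ⟩
  refine (ih _ hlt _ rfl).of_comp hdeg ?_ ?_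
  · intro β hβ
    have hder : aeval β φ.derivative = (β - a) ^ m * (β - c) ^ k *
        ((m + 1) * (β - c) + (k + 1) * (β - a)) := by
      rw [hφ, derivative_mul, derivative_X_sub_C_pow, derivative_X_sub_C_pow]
      simp
      ring
    rw [hder, mul_eq_zero, mul_eq_zero] at hβ
    rcases hβ with (hβ | hβ) | hβ
    · rw [sub_eq_zero.1 (eq_zero_of_pow_eq_zero hβ)]
      exact hroot a (A.min'_mem hne)
    · rw [sub_eq_zero.1 (eq_zero_of_pow_eq_zero hβ)]
      exact hroot c (A.max'_mem hne)
    · have hmC : ((b : ℂ) - a) * (k + 1) = (c - b) * (m + 1) := by exact_mod_cast hm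
      have h0 : ((m + k + 2 : ℕ) : ℂ) ≠ 0 := Nat.cast_ne_zero.2 (by omega)
      have : β = b := by
        apply mul_left_cancel₀ h0
        push_cast
        linear_combination hβ - hmC
      rw [this]
      exact hroot b hbA
  · intro β hβ
    obtain ⟨x, hx, rfl⟩ := aeval_prod_X_sub_C_eq_zero_iff.1 hβ
    exact hroot x hx

/-- The values of `φ` at the roots of `f` are roots of a polynomial of degree at most `deg f`. -/
lemma exists_natDegree_le_aeval_aeval_eq_zero {f : ℚ[X]} (hf : f ≠ 0) (φ : ℚ[X]) :
    ∃ G : ℚ[X], G ≠ 0 ∧ G.natDegree ≤ f.natDegree ∧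
      ∀ β : ℂ, aeval β f = 0 → aeval (aeval β φ) G = 0 := by
  have := (AdjoinRoot.powerBasis hf).finite
  refine ⟨minpoly ℚ (AdjoinRoot.mk f φ), minpoly.ne_zero (Algebra.IsIntegral.isIntegral _), ?_, ?_⟩
  · refine (minpoly.natDegree_le _).trans ?_
    rw [(AdjoinRoot.powerBasis hf).finrank, AdjoinRoot.powerBasis_dim]
  · intro β hβ
    let e : AdjoinRoot f →ₐ[ℚ] ℂ := AdjoinRoot.liftAlgHom f (Algebra.ofId ℚ ℂ) β hβ
    have he : e (AdjoinRoot.mk f φ) = aeval β φ := rfl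
    rw [← he, aeval_algHom_apply, minpoly.aeval, map_zero]

/-- Belyi's reduction to rational branch points. -/
lemma abcDominated_mul_prod (habc : ABCConjecture) (N : ℕ) :
    ∀ g : ℚ[X], g ≠ 0 → g.natDegree ≤ N → ∀ A : Finset ℚ,
      AbcDominated (g * ∏ a ∈ A, (X - C a)) := by
  classical
  induction N with
  | zero =>
    intro g hg hN A
    obtain ⟨h, h0, hb, hroot⟩ := abcDominated_prod_X_sub_C habc A
    refine ⟨h, h0, hb, fun β hβ => hroot β ?_⟩
    rw [map_mul, mul_eq_zero] at hβ
    refine hβ.resolve_left fun h1 => hg ?_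
    rw [eq_C_of_natDegree_le_zero hN] at h1 ⊢
    simpa using h1
  | succ N ih =>
    intro g hg hN A
    rcases Nat.lt_or_ge N g.natDegree with hlt | hle
    swap
    · exact ih g hg hle A
    have hg' : g.derivative ≠ 0 := fun h => by
      rw [derivative_eq_zero] at h
      omega
    obtain ⟨G, hG0, hGdeg, hG⟩ := exists_natDegree_le_aeval_aeval_eq_zero hg' g
    rw [natDegree_derivative] at hGdeg
    refine (ih G hG0 (by omega) (insert 0 (A.image fun x => g.eval x))).of_comp (φ := g)
      (by omega) ?_ ?_
    · intro β hβ
      rw [map_mul, hG β hβ, zero_mul]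
    · intro β hβ
      rw [map_mul, mul_eq_zero]
      right
      rw [aeval_prod_X_sub_C_eq_zero_iff]
      rw [map_mul, mul_eq_zero, aeval_prod_X_sub_C_eq_zero_iff] at hβ
      rcases hβ with hβ | ⟨a, ha, rfl⟩
      · exact ⟨0, Finset.mem_insert_self _ _, by simpa using hβ⟩
      · exact ⟨g.eval a, Finset.mem_insert_of_mem (Finset.mem_image_of_mem _ ha), by
          simpa using aeval_algebraMap_apply_eq_algebraMap_eval (A := ℂ) a g⟩

lemma abcDominated (habc : ABCConjecture) {g : ℚ[X]} (hg : g ≠ 0) : AbcDominated g := by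
  simpa using abcDominated_mul_prod habc g.natDegree g hg le_rfl ∅

end Belyi

section SquarefreeValues

lemma numRoots_eq_natDegree {g : ℚ[X]} (hg : Squarefree g) : numRoots g = g.natDegree := by
  have hsep := PerfectField.separable_iff_squarefree.2 hg
  rw [numRoots, Multiset.toFinset_card_of_nodup (nodup_roots hsep.map),
    ← (IsAlgClosed.splits _).natDegree_eq_card_roots, natDegree_map]

lemma dvd_of_squarefree {g h : ℚ[X]} (hg : Squarefree g) (hh : h ≠ 0)
    (hroot : ∀ β : ℂ, aeval β g = 0 → aeval β h = 0) : g ∣ h := by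
  have hsep := PerfectField.separable_iff_squarefree.2 hg
  rw [← map_dvd_map' (algebraMap ℚ ℂ)]
  refine (IsAlgClosed.splits _).dvd_of_roots_le_roots (map_ne_zero hg.ne_zero) ?_
  refine (Multiset.le_iff_subset (nodup_roots hsep.map)).2 fun β hβ => ?_
  exact mem_aroots.2 ⟨hh, hroot β (mem_aroots.1 hβ).2⟩

open UniqueFactorizationMonoid in
/-- A polynomial `h` that vanishes at the roots of the squarefree polynomial `f` has a radical of
the form `f * k`. -/
lemma exists_dvd_pow_mul {f h : ℚ[X]} (hf : Squarefree f) (hh : h ≠ 0)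
    (hroot : ∀ β : ℂ, aeval β f = 0 → aeval β h = 0) :
    ∃ k : ℚ[X], k ≠ 0 ∧ f.natDegree + k.natDegree = numRoots h ∧ (f * k) ∣ h ∧
      ∃ m, h ∣ (f * k) ^ m := by
  obtain ⟨k, hk⟩ := (dvd_radical_iff hf.isRadical hh).2 (dvd_of_squarefree hf hh hroot)
  have hk0 : k ≠ 0 := by
    rintro rfl
    exact radical_ne_zero (a := h) (by rw [hk, mul_zero])
  obtain ⟨m, hm⟩ := exists_dvd_radical_self_pow hh
  refine ⟨k, hk0, ?_, hk ▸ radical_dvd_self, m, hk ▸ hm⟩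
  rw [← natDegree_mul hf.ne_zero hk0, ← hk, ← numRoots_eq_natDegree squarefree_radical]
  unfold numRoots
  congr 1
  ext β
  simp only [Multiset.mem_toFinset, mem_aroots, hh, ne_eq, not_false_eq_true, true_and,
    radical_ne_zero]
  constructor
  · intro h0
    obtain ⟨q, hq⟩ := radical_dvd_self (a := h)
    rw [hq, map_mul, h0, zero_mul]
  · intro h0
    obtain ⟨q, hq⟩ := hm
    have h1 := congrArg (aeval β) hq
    rw [map_mul, h0, zero_mul, map_pow] at h1
    exact eq_zero_of_pow_eq_zero h1

/-- Under the abc conjecture, the radical of the value of a squarefree polynomial of degree `D` at a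
rational number of height `H` is at least about `H ^ (D - 2)`. -/
lemma exists_ratHeight_pow_le_intRadical (habc : ABCConjecture) {f : ℚ[X]} (hf : Squarefree f) :
    ∃ e : ℕ, ∀ ε : ℝ, 0 < ε → ∃ K : ℝ, 0 < K ∧ ∀ x : ℚ, f.eval x ≠ 0 →
      (ratHeight x : ℝ) ^ (f.natDegree + e - 1) ≤
        K * (IntRadical (f.eval x).num * (ratHeight x : ℝ) ^ (e + 1)) ^ (1 + ε) := by
  obtain ⟨h, hh, hb, hroot⟩ := abcDominated habc hf.ne_zero
  obtain ⟨k, hk0, hdeg, ⟨l, hl⟩, m, q, hq⟩ := exists_dvd_pow_mul hf hh hroot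
  refine ⟨k.natDegree, fun ε hε => ?_⟩
  rw [hdeg]
  obtain ⟨K, hK, hbK⟩ := hb ε hε
  obtain ⟨B, hB⟩ := exists_num_eval_le k
  obtain ⟨M, hM, hMd⟩ := exists_den_eval_dvd q
  set R : ℝ := ∑ x ∈ h.roots.toFinset, (ratHeight x : ℝ) ^ (numRoots h - 1) with hR
  have hM0 : (0 : ℝ) ≤ M := by exact_mod_cast hM.le
  have hMB : (0 : ℝ) ≤ M * B := by positivity
  have hR0 : 0 ≤ R := by positivity
  refine ⟨K * (M * B : ℝ) ^ (1 + ε) + R + 1, by positivity, fun x hfx => ?_⟩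
  have hH1 : (1 : ℝ) ≤ ratHeight x := by exact_mod_cast one_le_ratHeight x
  have hrad1 : (1 : ℝ) ≤ IntRadical (f.eval x).num := by exact_mod_cast one_le_intRadical _
  have hY1 : (1 : ℝ) ≤ (IntRadical (f.eval x).num * (ratHeight x : ℝ) ^ (k.natDegree + 1)) ^
      (1 + ε) :=
    Real.one_le_rpow (one_le_mul_of_one_le_of_one_le hrad1 (one_le_pow₀ hH1)) (by positivity)
  by_cases hx : h.eval x = 0
  · have h1 : (ratHeight x : ℝ) ^ (numRoots h - 1) ≤ R :=
      Finset.single_le_sum (f := fun x : ℚ => (ratHeight x : ℝ) ^ (numRoots h - 1))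
        (fun _ _ => by positivity) (Multiset.mem_toFinset.2 ((mem_roots hh).2 hx))
    have h2 : 0 ≤ K * (M * B : ℝ) ^ (1 + ε) := by positivity
    nlinarith
  · have hkx : k.eval x ≠ 0 := by
      intro h0
      rw [hl, eval_mul, eval_mul, h0] at hx
      simp at hx
    have hcond : abcConductor h x ≤ M.natAbs * (x.den * (IntRadical (f.eval x).num *
        (k.eval x).num.natAbs)) := by
      have hf0 := Rat.num_ne_zero.2 hfx
      have hk0 := Rat.num_ne_zero.2 hkx
      have hd0 : (x.den : ℤ) ≠ 0 := by exact_mod_cast x.den_nz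
      calc abcConductor h x
          ≤ IntRadical (M * (x.den * ((f.eval x).num * (k.eval x).num))) := by
            refine intRadical_le_of_forall_prime (by positivity) fun p hp hdvd => ?_
            have hp' := Nat.prime_iff_prime_int.1 hp
            by_contra hcon
            simp only [hp'.dvd_mul, not_or] at hcon hdvd
            obtain ⟨hpM, hpx, hpf, hpk⟩ := hcon
            have hph := hdvd.resolve_left hpx
            have hpq : ¬ (p : ℤ) ∣ (q.eval x).den := fun h1 => by
              rcases hp'.dvd_or_dvd (h1.trans (hMd x)) with h2 | h2
              · exact hpM h2
              · exact hpx (hp'.dvd_of_dvd_pow h2)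
            have hphd : ¬ (p : ℤ) ∣ (h.eval x).den := fun h1 =>
              hp'.not_isUnit ((isCoprime_num_den (h.eval x)).isUnit_of_dvd' hph h1)
            have h3 : (h.eval x).num * ((q.eval x).num * ((f.eval x).den * (k.eval x).den) ^ m)
                = ((f.eval x).num * (k.eval x).num) ^ m *
                  ((h.eval x).den * (q.eval x).den) := by
              have h4 : (f.eval x * k.eval x) ^ m = h.eval x * q.eval x := by
                rw [← eval_mul, ← eval_mul, ← eval_pow, hq]
              have : ((h.eval x).num * ((q.eval x).num * ((f.eval x).den * (k.eval x).den) ^ m) : ℚ)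
                  = ((f.eval x).num * (k.eval x).num) ^ m *
                    ((h.eval x).den * (q.eval x).den) := by
                simp only [← Rat.mul_den_eq_num]
                linear_combination (-(eval x h).den * (eval x q).den *
                  ((f.eval x).den * (k.eval x).den : ℚ) ^ m) * h4
              exact_mod_cast this
            rcases hp'.dvd_or_dvd (h3 ▸ hph.mul_right _) with h4 | h4
            · exact (hp'.dvd_or_dvd (hp'.dvd_of_dvd_pow h4)).elim hpf hpk
            · exact (hp'.dvd_or_dvd h4).elim hphd hpq
        _ ≤ IntRadical M * (IntRadical x.den * (IntRadical (f.eval x).num *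
              IntRadical (k.eval x).num)) := by
            refine (intRadical_mul_le hM.ne' (by positivity)).trans (Nat.mul_le_mul_left _ ?_)
            refine (intRadical_mul_le hd0 (by positivity)).trans (Nat.mul_le_mul_left _ ?_)
            exact intRadical_mul_le hf0 hk0
        _ ≤ _ := by
            gcongr
            · exact intRadical_le_natAbs hM.ne'
            · simpa using intRadical_le_natAbs hd0
            · exact intRadical_le_natAbs hk0
    have hcond' : (abcConductor h x : ℝ) ≤
        M * B * (IntRadical (f.eval x).num * (ratHeight x : ℝ) ^ (k.natDegree + 1)) := by
      have h1 : abcConductor h x ≤ M.natAbs * B *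
          (IntRadical (f.eval x).num * ratHeight x ^ (k.natDegree + 1)) := by
        calc abcConductor h x ≤ M.natAbs * (x.den * (IntRadical (f.eval x).num *
                (k.eval x).num.natAbs)) := hcond
          _ ≤ M.natAbs * (ratHeight x * (IntRadical (f.eval x).num *
                (B * ratHeight x ^ k.natDegree))) := by
              gcongr
              · exact den_le_ratHeight x
              · exact hB x hkx
          _ = _ := by ring
      have h2 : ((M.natAbs : ℕ) : ℝ) = M := by rw [Nat.cast_natAbs, abs_of_pos hM]
      rw [← h2]
      exact_mod_cast h1
    calc (ratHeight x : ℝ) ^ (numRoots h - 1) ≤ K * (abcConductor h x : ℝ) ^ (1 + ε) := hbK x hx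
      _ ≤ K * (M * B * (IntRadical (f.eval x).num *
            (ratHeight x : ℝ) ^ (k.natDegree + 1))) ^ (1 + ε) := by gcongr
      _ = K * (M * B : ℝ) ^ (1 + ε) * (IntRadical (f.eval x).num *
            (ratHeight x : ℝ) ^ (k.natDegree + 1)) ^ (1 + ε) := by
        rw [Real.mul_rpow hMB (by positivity), mul_assoc]
      _ ≤ _ := by
        gcongr
        linarith

end SquarefreeValues

section Twists

lemma intRadical_pow_dvd_s3 {n : ℕ} (hn : n ≠ 0) {d u t a b : ℤ} (hut : IsCoprime u t)
    (hab : IsCoprime a b) (h : d * a ^ n * t = u * b ^ n) :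
    (IntRadical u : ℤ) ^ n ∣ u * d ^ (n - 1) := by
  rw [IntRadical, Nat.cast_prod, ← Finset.prod_pow]
  refine Finset.prod_dvd_of_coprime (fun p hp q hq hpq => ?_) fun p hp => ?_
  · refine IsCoprime.pow (Nat.isCoprime_iff_coprime.2 ?_)
    exact (Nat.coprime_primes (Nat.prime_of_mem_primeFactors hp)
      (Nat.prime_of_mem_primeFactors hq)).2 hpq
  · have hp' := Nat.prime_iff_prime_int.1 (Nat.prime_of_mem_primeFactors hp)
    have hpu : (p : ℤ) ∣ u := Int.natCast_dvd.2 (Nat.dvd_of_mem_primeFactors hp)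
    by_cases hpd : (p : ℤ) ∣ d
    · obtain ⟨m, rfl⟩ := Nat.exists_eq_succ_of_ne_zero hn
      rw [pow_succ']
      exact mul_dvd_mul hpu (pow_dvd_pow_of_dvd hpd _)
    · have hpt : ¬ (p : ℤ) ∣ t := fun h1 => hp'.not_isUnit (hut.isUnit_of_dvd' hpu h1)
      have hpa : (p : ℤ) ∣ a := by
        rcases hp'.dvd_or_dvd (h ▸ hpu.mul_right _ : (p : ℤ) ∣ d * a ^ n * t) with h1 | h1
        · exact hp'.dvd_of_dvd_pow ((hp'.dvd_or_dvd h1).resolve_left hpd)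
        · exact absurd h1 hpt
      have hpb : ¬ (p : ℤ) ∣ b := fun h1 => hp'.not_isUnit (hab.isUnit_of_dvd' hpa h1)
      have h2 : (p : ℤ) ^ n ∣ u * b ^ n :=
        h ▸ ((pow_dvd_pow_of_dvd hpa n).mul_left d).mul_right t
      have hcop : IsCoprime ((p : ℤ) ^ n) (b ^ n) :=
        IsCoprime.pow (hp'.irreducible.coprime_iff_not_dvd.2 hpb)
      exact (hcop.dvd_of_dvd_mul_right h2).mul_right _

lemma intRadical_num_pow_le {n : ℕ} (hn : n ≠ 0) {d : ℤ} (hd : d ≠ 0) {v y : ℚ} (hv : v ≠ 0)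
    (h : d * y ^ n = v) :
    IntRadical v.num ^ n ≤ v.num.natAbs * d.natAbs ^ (n - 1) := by
  have hu : v.num ≠ 0 := Rat.num_ne_zero.2 hv
  have h1 : d * y.num ^ n * v.den = v.num * (y.den : ℤ) ^ n := by
    have : (d * y.num ^ n * v.den : ℚ) = v.num * (y.den : ℚ) ^ n := by
      simp only [← Rat.mul_den_eq_num, mul_pow, ← h]
      ring
    exact_mod_cast this
  have h2 := intRadical_pow_dvd_s3 hn (isCoprime_num_den v) (isCoprime_num_den y) h1
  have h3 := Int.natAbs_dvd_natAbs.2 h2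
  rw [Int.natAbs_mul, Int.natAbs_pow, Int.natAbs_pow, Int.natAbs_natCast] at h3
  exact Nat.le_of_dvd (by positivity) h3

lemma NthPowerFree.natAbs_eq_one {n : ℕ} {d d' a b : ℤ} (hd' : NthPowerFree n d')
    (hab : IsCoprime a b) (h : d * b ^ n = d' * a ^ n) : b.natAbs = 1 := by
  by_contra hb
  obtain ⟨p, hp, hpb⟩ := Nat.exists_prime_and_dvd hb
  have hp' := Nat.prime_iff_prime_int.1 hp
  have hpb : (p : ℤ) ∣ b := Int.natCast_dvd.2 hpb
  have hpa : ¬ (p : ℤ) ∣ a := fun h1 => hp'.not_isUnit (hab.isUnit_of_dvd' h1 hpb)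
  have h2 : (p : ℤ) ^ n ∣ d' * a ^ n := h ▸ (pow_dvd_pow_of_dvd hpb n).mul_left d
  have hcop : IsCoprime ((p : ℤ) ^ n) (a ^ n) :=
    IsCoprime.pow (hp'.irreducible.coprime_iff_not_dvd.2 hpa)
  exact hd'.2 p hp (hcop.dvd_of_dvd_mul_right h2)

/-- An `n`-th power free integer is determined up to sign by its class modulo `n`-th powers. -/
lemma NthPowerFree.natAbs_eq {n : ℕ} {d d' : ℤ} (hd : NthPowerFree n d) (hd' : NthPowerFree n d')
    {y y' : ℚ} (hy : y ≠ 0) (h : d * y ^ n = d' * y' ^ n) : d.natAbs = d'.natAbs := by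
  set z := y' / y with hz
  have h1 : d * (z.den : ℤ) ^ n = d' * z.num ^ n := by
    have : (d * z.den ^ n : ℚ) = d' * (z.num : ℚ) ^ n := by
      rw [← Rat.mul_den_eq_num z, mul_pow, hz, div_pow]
      field_simp
      rw [h]
    exact_mod_cast this
  have h2 := hd'.natAbs_eq_one (isCoprime_num_den z) h1
  have h3 := hd.natAbs_eq_one (isCoprime_num_den z).symm h1.symm
  have h4 := congrArg Int.natAbs h1
  rwa [Int.natAbs_mul, Int.natAbs_mul, Int.natAbs_pow, Int.natAbs_pow, h2, h3, one_pow, mul_one,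
    mul_one] at h4

lemma ncard_le_of_ratHeight_le {S : Set ℤ} {Y : ℝ} (hY : 1 ≤ Y) (x : ℤ → ℚ)
    (hx : ∀ d ∈ S, (ratHeight (x d) : ℝ) ≤ Y)
    (hinj : ∀ d ∈ S, ∀ d' ∈ S, x d = x d' → d.natAbs = d'.natAbs) :
    (S.ncard : ℝ) ≤ 6 * Y ^ 2 := by
  set L := ⌊Y⌋₊
  have hL : 1 ≤ L := Nat.one_le_floor_iff _ |>.2 hY
  have hLY : (L : ℝ) ≤ Y := Nat.floor_le (by linarith)
  set T : Finset ((ℤ × ℕ) × Bool) :=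
    (Finset.Icc (-(L : ℤ)) L ×ˢ Finset.Icc 1 L) ×ˢ Finset.univ with hT
  have hcard : T.card ≤ 6 * L ^ 2 := by
    rw [hT, Finset.card_product, Finset.card_product, Int.card_Icc, Nat.card_Icc, Finset.card_univ,
      Fintype.card_bool]
    have : ((L : ℤ) + 1 - -L).toNat = 2 * L + 1 := by omega
    rw [this, Nat.add_sub_cancel]
    nlinarith
  have hle : S.ncard ≤ (T : Set ((ℤ × ℕ) × Bool)).ncard := by
    refine Set.ncard_le_ncard_of_injOn (fun d => (((x d).num, (x d).den), decide (0 < d)))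
      (fun d hd => ?_) (fun d hd d' hd' heq => ?_) T.finite_toSet
    · have h1 : ratHeight (x d) ≤ L := Nat.le_floor (hx d hd)
      have h2 := abs_le.1 (abs_num_le_ratHeight (x d))
      have h3 := den_le_ratHeight (x d)
      have h4 := (x d).den_pos
      simp only [hT, Finset.mem_coe, Finset.mem_product, Finset.mem_Icc, Finset.mem_univ, and_true]
      omega
    · simp only [Prod.mk.injEq, decide_eq_decide] at heq
      have h1 := hinj d hd d' hd' (Rat.ext heq.1.1 heq.1.2)
      omega
  rw [Set.ncard_coe_finset] at hle
  calc (S.ncard : ℝ) ≤ ((6 * L ^ 2 : ℕ) : ℝ) := by exact_mod_cast hle.trans hcard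
    _ = 6 * (L : ℝ) ^ 2 := by push_cast; ring
    _ ≤ 6 * Y ^ 2 := by gcongr

/-- Under the abc conjecture, a rational point on the twist by `d` has height
`O(|d| ^ b)` for some `b < 1 / 2`. -/
lemma exists_ratHeight_le_rpow (habc : ABCConjecture) {n : ℕ} (hn : 2 ≤ n) {f : ℚ[X]}
    (hsf : Squarefree f) (hdeg : (4 * (n : ℝ) - 2) / ((n : ℝ) - 1) < f.natDegree) :
    ∃ b : ℝ, 0 < b ∧ 2 * b < 1 ∧ ∃ C : ℝ, 1 ≤ C ∧ ∀ X : ℝ, 1 ≤ X → ∀ d : ℤ, d ≠ 0 → |(d : ℝ)| ≤ X →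
      ∀ x y : ℚ, y ≠ 0 → d * y ^ n = f.eval x → (ratHeight x : ℝ) ≤ C * X ^ b := by
  obtain ⟨e, he⟩ := exists_ratHeight_pow_le_intRadical habc hsf
  obtain ⟨B, hB⟩ := exists_num_eval_le f
  set D := f.natDegree with hD
  have hn0 : n ≠ 0 := by omega
  have hn2 : (2 : ℝ) ≤ n := by exact_mod_cast hn
  have hgap : 0 < (D : ℝ) - 2 - D / n - 2 * (1 - 1 / n) := by
    rw [div_lt_iff₀ (by linarith)] at hdeg
    have : (D : ℝ) - 2 - D / n - 2 * (1 - 1 / n) = (D * (n - 1) - (4 * n - 2)) / n := by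
      field_simp
      ring
    rw [this]
    exact div_pos (by linarith) (by linarith)
  have hn1 : (0 : ℝ) < 1 - 1 / n := by
    rw [sub_pos, div_lt_one (by linarith)]
    linarith
  have hD1 : 1 ≤ D := by
    have h1 : (0 : ℝ) ≤ D / n := by positivity
    have h2 : (0 : ℝ) < D := by linarith
    exact_mod_cast h2
  set A : ℝ := D / n + e + 1 with hA
  have hA0 : 0 < A := by positivity
  set s : ℝ := (D : ℝ) - 2 - D / n - 2 * (1 - 1 / n) with hs
  set ε : ℝ := s / (2 * (A + 2)) with hε
  have hε0 : 0 < ε := by positivity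
  have hεs : ε * (A + 2) = s / 2 := by
    rw [hε]
    field_simp
  set γ : ℝ := (1 - 1 / n) * (1 + ε) with hγ
  have hγ0 : 0 < γ := by positivity
  set E : ℝ := D + e - 1 - A * (1 + ε) with hE
  have hEγ : 2 * γ < E := by
    have h1 : E - 2 * γ = s - ε * (A + 2 * (1 - 1 / n)) := by
      rw [hE, hγ, hs, hA]
      ring
    have h2 : (0 : ℝ) < 1 / n := by positivity
    nlinarith
  have hE0 : 0 < E := by linarith
  obtain ⟨K, hK, hbK⟩ := he ε hε0
  set C₀ : ℝ := K * ((B : ℝ) ^ (1 / n : ℝ)) ^ (1 + ε) + 1 with hC₀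
  have hC₀1 : 1 ≤ C₀ := by
    have : 0 ≤ K * ((B : ℝ) ^ (1 / n : ℝ)) ^ (1 + ε) := by positivity
    linarith
  refine ⟨γ / E, by positivity, ?_, C₀ ^ (1 / E), Real.one_le_rpow hC₀1 (by positivity), ?_⟩
  · rw [← mul_div_assoc, div_lt_one hE0]
    exact hEγ
  intro X hX d hd hdX x y hy hxy
  have hX0 : 0 < X := by linarith
  have hfx : f.eval x ≠ 0 := by
    rw [← hxy]
    exact mul_ne_zero (by exact_mod_cast hd) (pow_ne_zero _ hy)
  have hH1 : (1 : ℝ) ≤ ratHeight x := by exact_mod_cast one_le_ratHeight x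
  have hnum : ((f.eval x).num.natAbs : ℝ) ≤ B * (ratHeight x : ℝ) ^ D := by
    exact_mod_cast hB x hfx
  set H := (ratHeight x : ℝ)
  have hH0 : 0 < H := by linarith
  have hrad : (IntRadical (f.eval x).num : ℝ) ≤
      (B : ℝ) ^ (1 / n : ℝ) * H ^ (D / n : ℝ) * X ^ (1 - 1 / n : ℝ) := by
    have h1 : (IntRadical (f.eval x).num : ℝ) ^ n ≤ B * H ^ D * X ^ (n - 1) := by
      calc (IntRadical (f.eval x).num : ℝ) ^ n
          ≤ ((f.eval x).num.natAbs : ℝ) * (d.natAbs : ℝ) ^ (n - 1) := by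
            exact_mod_cast intRadical_num_pow_le hn0 hd hfx hxy
        _ ≤ (B * H ^ D) * X ^ (n - 1) := by
            have h3 : (d.natAbs : ℝ) ≤ X := by rwa [Nat.cast_natAbs, Int.cast_abs]
            gcongr
    have h2 : (IntRadical (f.eval x).num : ℝ) =
        ((IntRadical (f.eval x).num : ℝ) ^ n) ^ (1 / n : ℝ) := by
      rw [one_div, Real.pow_rpow_inv_natCast (by positivity) hn0]
    rw [h2]
    refine (Real.rpow_le_rpow (by positivity) h1 (by positivity)).trans_eq ?_
    rw [Real.mul_rpow (by positivity) (by positivity), Real.mul_rpow (by positivity)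
      (by positivity), ← Real.rpow_natCast, ← Real.rpow_natCast, ← Real.rpow_mul hH0.le,
      ← Real.rpow_mul hX0.le, Nat.cast_sub (by omega)]
    congr 2
    · rw [mul_one_div]
    · field_simp
      simp
  have hmain : H ^ E ≤ C₀ * X ^ γ := by
    have h1 : H ^ ((D : ℝ) + e - 1) ≤
        K * ((B : ℝ) ^ (1 / n : ℝ)) ^ (1 + ε) * X ^ γ * H ^ (A * (1 + ε)) := by
      calc H ^ ((D : ℝ) + e - 1) = H ^ (D + e - 1) := by
            rw [← Real.rpow_natCast, Nat.cast_sub (by omega)]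
            push_cast
            rfl
        _ ≤ K * (IntRadical (f.eval x).num * H ^ (e + 1)) ^ (1 + ε) := hbK x hfx
        _ ≤ K * ((B : ℝ) ^ (1 / n : ℝ) * H ^ (D / n : ℝ) * X ^ (1 - 1 / n : ℝ) *
              H ^ (e + 1)) ^ (1 + ε) := by gcongr
        _ = K * ((B : ℝ) ^ (1 / n : ℝ) * X ^ (1 - 1 / n : ℝ) * H ^ A) ^ (1 + ε) := by
            have : H ^ A = H ^ (D / n : ℝ) * H ^ (e + 1) := by
              rw [← Real.rpow_natCast, ← Real.rpow_add hH0, hA]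
              push_cast
              ring_nf
            rw [this]
            ring_nf
        _ = _ := by
            rw [Real.mul_rpow (by positivity) (by positivity), Real.mul_rpow (by positivity)
              (by positivity), ← Real.rpow_mul hX0.le, ← Real.rpow_mul hH0.le]
            ring
    rw [hE, Real.rpow_sub hH0, div_le_iff₀ (by positivity)]
    refine h1.trans ?_
    gcongr
    linarith
  calc (ratHeight x : ℝ) = (H ^ E) ^ (1 / E) := by
        rw [← Real.rpow_mul hH0.le, mul_one_div_cancel hE0.ne', Real.rpow_one]
    _ ≤ (C₀ * X ^ γ) ^ (1 / E) := by gcongr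
    _ = C₀ ^ (1 / E) * X ^ (γ / E) := by
        rw [Real.mul_rpow (by positivity) (by positivity), ← Real.rpow_mul hX0.le, mul_one_div]

end Twists

/-- Assuming the abc conjecture, for `deg f > (4n-2)/(n-1)` the number of
`n`-th power free `d` with `|d| ≤ X` whose twist has a nontrivial rational
point is `≪ X^a` for some `a < 1`. -/
theorem stmt_3 (habc : ABCConjecture) (n : ℕ) (hn : 2 ≤ n) (f : Polynomial ℤ)
    (hsf : Squarefree (f.map (Int.castRingHom ℚ)))
    (hdeg : (4 * (n : ℝ) - 2) / ((n : ℝ) - 1) < f.natDegree) :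
    ∃ a : ℝ, a < 1 ∧ ∃ K : ℝ, 0 < K ∧ ∀ X : ℝ, 2 ≤ X →
      ({d : ℤ | |(d : ℝ)| ≤ X ∧ NthPowerFree n d ∧
          ∃ x y : ℚ, y ≠ 0 ∧ (d : ℚ) * y ^ n = Polynomial.aeval x f}.ncard : ℝ)
        ≤ K * X ^ a := by
  have hnat : (f.map (Int.castRingHom ℚ)).natDegree = f.natDegree :=
    natDegree_map_eq_of_injective (Int.cast_injective) f
  have haeval (x : ℚ) : aeval x f = (f.map (Int.castRingHom ℚ)).eval x := by
    rw [eval_map, aeval_def]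
    rfl
  obtain ⟨b, hb0, hb1, C, hC, hbound⟩ :=
    exists_ratHeight_le_rpow habc hn hsf (by rwa [hnat])
  refine ⟨2 * b, hb1, 6 * C ^ 2, by positivity, fun X hX => ?_⟩
  set S := {d : ℤ | |(d : ℝ)| ≤ X ∧ NthPowerFree n d ∧
    ∃ x y : ℚ, y ≠ 0 ∧ (d : ℚ) * y ^ n = aeval x f}
  have hpoint : ∀ d : ℤ, ∃ x y : ℚ, d ∈ S → y ≠ 0 ∧ (d : ℚ) * y ^ n = aeval x f := fun d => by
    by_cases hd : d ∈ S
    · obtain ⟨x, y, h⟩ := hd.2.2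
      exact ⟨x, y, fun _ => h⟩
    · exact ⟨0, 0, fun h => absurd h hd⟩
  choose x y hxy using hpoint
  have hX1 : 1 ≤ X := by linarith
  have hY : 1 ≤ C * X ^ b :=
    one_le_mul_of_one_le_of_one_le hC (Real.one_le_rpow hX1 hb0.le)
  have hcount : (S.ncard : ℝ) ≤ 6 * (C * X ^ b) ^ 2 := by
    refine ncard_le_of_ratHeight_le hY x (fun d hd => ?_) fun d hd d' hd' h => ?_
    · exact hbound X hX1 d hd.2.1.1 hd.1 _ _ (hxy d hd).1 (haeval _ ▸ (hxy d hd).2)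
    · exact hd.2.1.natAbs_eq hd'.2.1 (hxy d hd).1
        (by rw [(hxy d hd).2, (hxy d' hd').2, h])
  refine hcount.trans_eq ?_
  rw [mul_pow, ← Real.rpow_mul_natCast (by linarith), mul_assoc]
  norm_num [mul_comm]
end
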